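/- arXiv:1506.06174 — 2 statements merged into one kernel-verified Lean document; each statement's English description precedes it below -/
import Mathlib

section
/- Let γ be the standard Gaussian measure on ℝⁿ. Then there is a universal constant c (independent of n and A) such that for any Borel set A ⊂ ℝⁿ with γ(A) > 0, the subgaussian constant of the normalized restricted measure γ_A (with respect to the Euclidean metric) satisfies σ²(γ_A) ≤ c · log(e/γ(A)). -/
open MeasureTheory Real Filter

/-- The ψ_α Orlicz-type norm of `f` with respect to `μ`:
`inf { r > 0 : ∫ exp((|f|/r)^α) dμ ≤ 2 }`. -/
noncomputable def psiNorm {M : Type*} [MeasurableSpace M] (μ : Measure M) (α : ℝ)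
    (f : M → ℝ) : ℝ :=
  sInf {r : ℝ | 0 < r ∧ ∫ x, Real.exp ((|f x| / r) ^ α) ∂μ ≤ 2}

/-- `σ2` is an admissible subgaussian bound for the metric probability space `(M,d,μ)`:
`∫ e^{tf} dμ ≤ e^{σ2 t²/2}` for all `t ∈ ℝ` and all `f` with `μ`-mean zero and
Lipschitz semi-norm at most 1. -/
def IsSubgaussianBound {M : Type*} [PseudoMetricSpace M] [MeasurableSpace M]
    (μ : Measure M) (σ2 : ℝ) : Prop :=
  0 ≤ σ2 ∧ ∀ f : M → ℝ, LipschitzWith 1 f → (∫ x, f x ∂μ) = 0 →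
    ∀ t : ℝ, ∫ x, Real.exp (t * f x) ∂μ ≤ Real.exp (σ2 * t ^ 2 / 2)

/-- The subgaussian constant `σ²(μ)` of a metric probability space. -/
noncomputable def subgaussianConst {M : Type*} [PseudoMetricSpace M] [MeasurableSpace M]
    (μ : Measure M) : ℝ :=
  sInf {σ2 : ℝ | IsSubgaussianBound μ σ2}

/-- The normalized restricted measure `μ_A`, viewed as a measure on the metric
(sub)space `A`. -/
noncomputable def restrictedMeasure {M : Type*} [MeasurableSpace M] (μ : Measure M)
    (A : Set M) : Measure A :=
  (ProbabilityTheory.cond μ A).comap Subtype.val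

/-- The standard Gaussian measure on Euclidean space `ℝⁿ`, with density
`(2π)^{−n/2} e^{−|x|²/2}` with respect to Lebesgue measure. -/
noncomputable def stdGaussian (n : ℕ) : Measure (EuclideanSpace ℝ (Fin n)) :=
  volume.withDensity fun x =>
    ENNReal.ofReal ((2 * Real.pi) ^ (-(n : ℝ) / 2) * Real.exp (-‖x‖ ^ 2 / 2))

open scoped ContDiff Convolution RealInnerProductSpace ENNReal

theorem isFiniteMeasure_stdGaussian (n : ℕ) : IsFiniteMeasure (stdGaussian n) := by
  refine isFiniteMeasure_withDensity_ofReal (Integrable.hasFiniteIntegral ?_)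
  refine Integrable.const_mul ?_ _
  have h := (GaussianFourier.integrable_cexp_neg_mul_sq_norm_add (b := 1 / 2)
    (by norm_num) 0 (0 : EuclideanSpace ℝ (Fin n))).norm
  refine h.congr (ae_of_all _ fun v => ?_)
  have : (-(1 / 2) * (‖v‖ : ℂ) ^ 2 + 0 * (⟪(0 : EuclideanSpace ℝ (Fin n)), v⟫ : ℂ))
      = ((-‖v‖ ^ 2 / 2 : ℝ) : ℂ) := by push_cast; ring
  simp only [this, Complex.norm_exp, Complex.ofReal_re]

theorem stdGaussian_eq (n : ℕ) :
    stdGaussian n = ProbabilityTheory.stdGaussian (EuclideanSpace ℝ (Fin n)) := by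
  have := isFiniteMeasure_stdGaussian n
  apply Measure.ext_of_charFun
  ext w
  rw [ProbabilityTheory.charFun_stdGaussian, charFun_apply, stdGaussian,
    integral_withDensity_eq_integral_toReal_smul (by fun_prop) (by simp)]
  have h := GaussianFourier.integral_cexp_neg_mul_sq_norm_add (b := 1 / 2)
    (by norm_num) Complex.I w
  have h2 : ∀ x : EuclideanSpace ℝ (Fin n),
      (ENNReal.ofReal ((2 * π) ^ (-(n : ℝ) / 2) * Real.exp (-‖x‖ ^ 2 / 2))).toReal •
        Complex.exp (⟪x, w⟫ * Complex.I) = (((2 * π) ^ (-(n : ℝ) / 2) : ℝ) : ℂ) *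
        Complex.exp (-(1 / 2) * ‖x‖ ^ 2 + Complex.I * ⟪w, x⟫) := by
    intro x
    rw [ENNReal.toReal_ofReal (by positivity), Complex.real_smul, Complex.ofReal_mul, mul_assoc,
      Complex.ofReal_exp, ← Complex.exp_add, real_inner_comm]
    congr 2
    push_cast
    ring
  simp_rw [h2]
  rw [integral_const_mul, h, ← mul_assoc]
  have h3 : (π : ℂ) / (1 / 2) = ((2 * π : ℝ) : ℂ) := by push_cast; ring
  have h4 : ((Module.finrank ℝ (EuclideanSpace ℝ (Fin n)) : ℂ) / 2) = ((n / 2 : ℝ) : ℂ) := by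
    simp
  rw [h3, h4, ← Complex.ofReal_cpow (by positivity), ← Complex.ofReal_mul,
    ← Real.rpow_add (by positivity)]
  simp only [neg_div, neg_add_cancel, Real.rpow_zero, Complex.ofReal_one, one_mul]
  congr 1
  simp only [Complex.I_sq]
  ring

/-- The exponential moment of a continuous linear form under the standard Gaussian measure. -/
theorem lintegral_exp_strongDual_stdGaussian {E : Type*} [NormedAddCommGroup E]
    [InnerProductSpace ℝ E] [FiniteDimensional ℝ E] [MeasurableSpace E] [BorelSpace E]
    (L : StrongDual ℝ E) (t : ℝ) :
    ∫⁻ x, ENNReal.ofReal (Real.exp (t * L x)) ∂ProbabilityTheory.stdGaussian E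
      = ENNReal.ofReal (Real.exp (‖L‖ ^ 2 * t ^ 2 / 2)) := by
  have h := ProbabilityTheory.IsGaussian.map_eq_gaussianReal
    (μ := ProbabilityTheory.stdGaussian E) L
  rw [ProbabilityTheory.integral_strongDual_stdGaussian,
    ProbabilityTheory.variance_dual_stdGaussian] at h
  have hm : ∫⁻ x, ENNReal.ofReal (Real.exp (t * L x)) ∂ProbabilityTheory.stdGaussian E
      = ∫⁻ y, ENNReal.ofReal (Real.exp (t * y))
          ∂((ProbabilityTheory.stdGaussian E).map L) := by
    rw [lintegral_map (by fun_prop) (by fun_prop)]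
  rw [hm, h, ← ofReal_integral_eq_lintegral_ofReal
    (ProbabilityTheory.integrable_exp_mul_gaussianReal t) (ae_of_all _ fun _ => by positivity)]
  have h5 := congrFun (ProbabilityTheory.mgf_fun_id_gaussianReal (μ := 0)
    (v := (‖L‖ ^ 2).toNNReal)) t
  rw [ProbabilityTheory.mgf] at h5
  rw [h5, Real.coe_toNNReal _ (by positivity)]
  simp

/-- A Lipschitz function is a uniform limit of smooth functions with the same Lipschitz
constant. -/
theorem LipschitzWith.exists_contDiff_dist_le {E : Type*} [NormedAddCommGroup E]
    [NormedSpace ℝ E] [FiniteDimensional ℝ E] {F : E → ℝ} (hF : LipschitzWith 1 F) {ε : ℝ}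
    (hε : 0 < ε) :
    ∃ g : E → ℝ, ContDiff ℝ ∞ g ∧ LipschitzWith 1 g ∧ ∀ x, |g x - F x| ≤ ε := by
  borelize E
  let μ : Measure E := Measure.addHaar
  let φ : ContDiffBump (0 : E) := ⟨ε / 2, ε, half_pos hε, half_lt_self hε⟩
  have hc := hF.continuous
  have hint : ∀ x, Integrable (fun y => φ.normed μ y * F (x - y)) μ := fun x =>
    (φ.continuous_normed.mul (by fun_prop)).integrable_of_hasCompactSupport
      (φ.hasCompactSupport_normed.mul_right)
  refine ⟨(φ.normed μ ⋆[ContinuousLinearMap.lsmul ℝ ℝ, μ] F),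
    φ.hasCompactSupport_normed.contDiff_convolution_left _ φ.contDiff_normed
      (hc.locallyIntegrable (μ := μ)), ?_, fun x => ?_⟩
  · refine LipschitzWith.of_dist_le_mul fun x y => ?_
    simp only [convolution_def, ContinuousLinearMap.lsmul_apply, smul_eq_mul, Real.dist_eq,
      NNReal.coe_one, one_mul]
    rw [← integral_sub (hint x) (hint y), ← Real.norm_eq_abs]
    calc _ ≤ ∫ t, φ.normed μ t * dist x y ∂μ := by
            refine norm_integral_le_of_norm_le (φ.integrable_normed.mul_const _)
              (ae_of_all _ fun t => ?_)
            rw [← mul_sub, norm_mul, Real.norm_of_nonneg (φ.nonneg_normed t), ← dist_eq_norm]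
            refine mul_le_mul_of_nonneg_left ?_ (φ.nonneg_normed t)
            simpa using hF.dist_le_mul (x - t) (y - t)
      _ = dist x y := by rw [integral_mul_const, φ.integral_normed, one_mul]
  · rw [← Real.dist_eq]
    refine φ.dist_normed_convolution_le hc.aestronglyMeasurable fun y hy => ?_
    have := hF.dist_le_mul y x
    rw [NNReal.coe_one, one_mul] at this
    exact this.trans (Metric.mem_ball.1 hy).le

/-- Jensen inequality for the exponential of an increment along a quarter of the rotation
orbit of `(x, y)`. -/
theorem exp_sub_le_integral_fderiv_rotation {E : Type*} [NormedAddCommGroup E]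
    [NormedSpace ℝ E] {F : E → ℝ} (hF : ContDiff ℝ ∞ F) (s : ℝ) (p : E × E) :
    Real.exp (s * (F p.2 - F p.1)) ≤ ∫ u in Set.Ioc (0 : ℝ) 1,
      Real.exp (s * (π / 2) * fderiv ℝ F (ContinuousLinearMap.rotation (π / 2 * u) p).1
        (ContinuousLinearMap.rotation (π / 2 * u) p).2) := by
  simp only [ContinuousLinearMap.rotation_apply]
  set c : ℝ → E := fun u => Real.cos (π / 2 * u) • p.1 + Real.sin (π / 2 * u) • p.2 with hc
  set c' : ℝ → E := fun u => -Real.sin (π / 2 * u) • p.1 + Real.cos (π / 2 * u) • p.2 with hc'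
  have hcd : ∀ u, HasDerivAt c ((π / 2) • c' u) u := by
    intro u
    have h0 : HasDerivAt (fun u : ℝ => π / 2 * u) (π / 2) u := by
      simpa using (hasDerivAt_id u).const_mul (π / 2)
    convert! (h0.cos.smul_const p.1).add (h0.sin.smul_const p.2) using 1
    simp only [hc', smul_add, smul_smul]
    congr 2 <;> ring
  have hd : Differentiable ℝ F := hF.differentiable (by simp)
  have hFd : ∀ u, HasDerivAt (fun u => s * F (c u)) (s * (π / 2) * fderiv ℝ F (c u) (c' u)) u := by
    intro u
    have := ((hd (c u)).hasFDerivAt.comp_hasDerivAt u (hcd u)).const_mul s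
    rw [map_smul, smul_eq_mul, ← mul_assoc] at this
    exact this
  have hcont : Continuous fun u => s * (π / 2) * fderiv ℝ F (c u) (c' u) := by
    have := hF.continuous_fderiv (by simp)
    fun_prop
  have hftc := intervalIntegral.integral_eq_sub_of_hasDerivAt (a := 0) (b := 1)
    (fun u _ => hFd u) (hcont.intervalIntegrable 0 1)
  have he : s * (F p.2 - F p.1) = ∫ u in Set.Ioc (0 : ℝ) 1,
      s * (π / 2) * fderiv ℝ F (c u) (c' u) := by
    rw [← intervalIntegral.integral_of_le zero_le_one, hftc]
    simp [hc, mul_sub]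
  rw [he]
  have : IsProbabilityMeasure ((volume : Measure ℝ).restrict (Set.Ioc 0 1)) := ⟨by simp⟩
  exact convexOn_exp.map_integral_le Real.continuous_exp.continuousOn isClosed_univ
    (ae_of_all _ fun _ => Set.mem_univ _)
    ((hcont.integrableOn_Icc).mono_set Set.Ioc_subset_Icc_self)
    (((Real.continuous_exp.comp hcont).integrableOn_Icc).mono_set Set.Ioc_subset_Icc_self)

theorem lintegral_exp_mul_lintegral_exp_neg_le_of_contDiff {E : Type*} [NormedAddCommGroup E]
    [InnerProductSpace ℝ E] [FiniteDimensional ℝ E] [MeasurableSpace E] [BorelSpace E]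
    {F : E → ℝ} (hF : ContDiff ℝ ∞ F) (hL : LipschitzWith 1 F) (s : ℝ) :
    (∫⁻ x, ENNReal.ofReal (Real.exp (-s * F x)) ∂ProbabilityTheory.stdGaussian E) *
      ∫⁻ x, ENNReal.ofReal (Real.exp (s * F x)) ∂ProbabilityTheory.stdGaussian E
      ≤ ENNReal.ofReal (Real.exp (2 * s ^ 2)) := by
  set γ := ProbabilityTheory.stdGaussian E with hγ
  have hc := hF.continuous
  have hfd : Continuous (fderiv ℝ F) := hF.continuous_fderiv (by simp)
  set G : E × E → ENNReal :=
    fun p => ENNReal.ofReal (Real.exp (s * (π / 2) * fderiv ℝ F p.1 p.2)) with hG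
  have hGm : Measurable G := by
    have : Continuous fun p : E × E => fderiv ℝ F p.1 p.2 := by fun_prop
    exact ENNReal.measurable_ofReal.comp (Real.continuous_exp.comp (this.const_mul _)).measurable
  have hrot : Continuous fun q : (E × E) × ℝ => ContinuousLinearMap.rotation (π / 2 * q.2) q.1 := by
    simp only [ContinuousLinearMap.rotation_apply]
    fun_prop
  have hpt : ∀ p : E × E, ENNReal.ofReal (Real.exp (s * (F p.2 - F p.1))) ≤
      ∫⁻ u in Set.Ioc (0 : ℝ) 1, G (ContinuousLinearMap.rotation (π / 2 * u) p) := by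
    intro p
    refine (ENNReal.ofReal_le_ofReal (exp_sub_le_integral_fderiv_rotation hF s p)).trans ?_
    rw [ofReal_integral_eq_lintegral_ofReal _ (ae_of_all _ fun _ => by positivity)]
    refine (Continuous.integrableOn_Icc ?_).mono_set Set.Ioc_subset_Icc_self
    simp only [ContinuousLinearMap.rotation_apply]
    fun_prop
  have hGint : ∫⁻ p, G p ∂(γ.prod γ) ≤ ENNReal.ofReal (Real.exp (2 * s ^ 2)) := by
    rw [lintegral_prod _ hGm.aemeasurable]
    calc _ ≤ ∫⁻ _ : E, ENNReal.ofReal (Real.exp (2 * s ^ 2)) ∂γ := by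
          refine lintegral_mono fun x => ?_
          simp only [hG]
          rw [hγ, lintegral_exp_strongDual_stdGaussian]
          refine ENNReal.ofReal_le_ofReal (Real.exp_le_exp.2 ?_)
          have h1 : ‖fderiv ℝ F x‖ ≤ 1 := by simpa using norm_fderiv_le_of_lipschitz ℝ (x₀ := x) hL
          have h2 : ‖fderiv ℝ F x‖ ^ 2 ≤ 1 := pow_le_one₀ (norm_nonneg _) h1
          have h3 : π ^ 2 ≤ 16 := by nlinarith [Real.pi_le_four, Real.pi_pos]
          have h4 : (s * (π / 2)) ^ 2 ≤ 4 * s ^ 2 := by nlinarith [sq_nonneg s]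
          nlinarith [sq_nonneg (s * (π / 2))]
      _ = _ := by simp
  calc _ = ∫⁻ p : E × E, ENNReal.ofReal (Real.exp (-s * F p.1)) * ENNReal.ofReal (Real.exp (s * F p.2))
        ∂(γ.prod γ) := (lintegral_prod_mul (by fun_prop) (by fun_prop)).symm
    _ ≤ ∫⁻ p : E × E, (∫⁻ u in Set.Ioc (0 : ℝ) 1,
        G (ContinuousLinearMap.rotation (π / 2 * u) p)) ∂(γ.prod γ) := by
      refine lintegral_mono fun p => le_trans (le_of_eq ?_) (hpt p)
      rw [← ENNReal.ofReal_mul (by positivity), ← Real.exp_add]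
      congr 2
      ring
    _ = ∫⁻ u in Set.Ioc (0 : ℝ) 1, (∫⁻ p : E × E,
        G (ContinuousLinearMap.rotation (π / 2 * u) p) ∂(γ.prod γ)) := lintegral_lintegral_swap (hGm.comp hrot.measurable).aemeasurable
    _ = ∫⁻ u in Set.Ioc (0 : ℝ) 1, (∫⁻ p, G p ∂(γ.prod γ)) := by
      refine lintegral_congr fun u => ?_
      rw [← lintegral_map hGm (by fun_prop),
        ProbabilityTheory.IsGaussian.map_rotation_eq_self_of_forall_strongDual_eq_zero
          ProbabilityTheory.integral_strongDual_stdGaussian]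
    _ = ∫⁻ p, G p ∂(γ.prod γ) := by simp
    _ ≤ _ := hGint

/-- Gaussian concentration for Lipschitz functions, in symmetrized exponential form. -/
theorem lintegral_exp_mul_lintegral_exp_neg_le {E : Type*} [NormedAddCommGroup E]
    [InnerProductSpace ℝ E] [FiniteDimensional ℝ E] [MeasurableSpace E] [BorelSpace E]
    {F : E → ℝ} (hL : LipschitzWith 1 F) (s : ℝ) :
    (∫⁻ x, ENNReal.ofReal (Real.exp (-s * F x)) ∂ProbabilityTheory.stdGaussian E) *
      ∫⁻ x, ENNReal.ofReal (Real.exp (s * F x)) ∂ProbabilityTheory.stdGaussian E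
      ≤ ENNReal.ofReal (Real.exp (3 * s ^ 2)) := by
  rcases eq_or_ne s 0 with rfl | hs
  · simp
  obtain ⟨g, hg, hgL, hgF⟩ := hL.exists_contDiff_dist_le (ε := |s| / 2) (by positivity)
  have key : ∀ r : ℝ, |r| = |s| →
      ∫⁻ x, ENNReal.ofReal (Real.exp (r * F x)) ∂ProbabilityTheory.stdGaussian E ≤
      ENNReal.ofReal (Real.exp (s ^ 2 / 2)) *
        ∫⁻ x, ENNReal.ofReal (Real.exp (r * g x)) ∂ProbabilityTheory.stdGaussian E := by
    intro r hr
    rw [← lintegral_const_mul' _ _ ENNReal.ofReal_ne_top]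
    refine lintegral_mono fun x => ?_
    rw [← ENNReal.ofReal_mul (by positivity), ← Real.exp_add]
    refine ENNReal.ofReal_le_ofReal (Real.exp_le_exp.2 ?_)
    have h1 : r * (F x - g x) ≤ |r| * |g x - F x| := by
      rw [← abs_mul, ← abs_neg]
      exact (le_of_eq (by ring)).trans (le_abs_self _)
    have h2 : |r| * |g x - F x| ≤ |s| * (|s| / 2) := by
      rw [hr]
      exact mul_le_mul_of_nonneg_left (hgF x) (abs_nonneg s)
    nlinarith [sq_abs s]
  calc _ ≤ (ENNReal.ofReal (Real.exp (s ^ 2 / 2)) * _) *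
        (ENNReal.ofReal (Real.exp (s ^ 2 / 2)) * _) :=
        mul_le_mul' (key (-s) (abs_neg s)) (key s rfl)
    _ = ENNReal.ofReal (Real.exp (s ^ 2)) * (_ * _) := by
        rw [mul_mul_mul_comm, ← ENNReal.ofReal_mul (by positivity), ← Real.exp_add, add_halves]
    _ ≤ ENNReal.ofReal (Real.exp (s ^ 2)) * ENNReal.ofReal (Real.exp (2 * s ^ 2)) :=
        mul_le_mul_right (lintegral_exp_mul_lintegral_exp_neg_le_of_contDiff hg hgL s) _
    _ = _ := by
        rw [← ENNReal.ofReal_mul (by positivity), ← Real.exp_add]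
        congr 2
        ring

theorem lintegral_exp_sq_div_four_gaussianReal_le :
    ∫⁻ g, ENNReal.ofReal (Real.exp (g ^ 2 / 4)) ∂ProbabilityTheory.gaussianReal 0 1
      ≤ ENNReal.ofReal (Real.exp 2) := by
  rw [ProbabilityTheory.gaussianReal_of_var_ne_zero 0 one_ne_zero,
    lintegral_withDensity_eq_lintegral_mul _ (ProbabilityTheory.measurable_gaussianPDF 0 1)
      (by fun_prop)]
  have h : ∀ g : ℝ, (ProbabilityTheory.gaussianPDF 0 1 *
      fun g : ℝ => ENNReal.ofReal (Real.exp (g ^ 2 / 4))) g =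
      ENNReal.ofReal ((√(2 * π))⁻¹ * Real.exp (-(1 / 4) * g ^ 2)) := by
    intro g
    rw [Pi.mul_apply, ProbabilityTheory.gaussianPDF, ProbabilityTheory.gaussianPDFReal,
      ← ENNReal.ofReal_mul (by positivity), mul_assoc, ← Real.exp_add]
    simp only [NNReal.coe_one, mul_one, sub_zero]
    congr 3
    ring
  simp_rw [h]
  rw [← ofReal_integral_eq_lintegral_ofReal
    ((integrable_exp_neg_mul_sq (by norm_num)).const_mul _) (ae_of_all _ fun _ => by positivity),
    integral_const_mul, integral_gaussian]
  refine ENNReal.ofReal_le_ofReal ?_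
  have h1 : π / (1 / 4) = 2 * (2 * π) := by ring
  rw [h1, Real.sqrt_mul zero_le_two (2 * π), mul_left_comm, inv_mul_cancel₀ (by positivity),
    mul_one]
  have h2 : √2 ≤ 2 := by rw [Real.sqrt_le_left (by norm_num)]; norm_num
  linarith [Real.add_one_le_exp (2 : ℝ)]

theorem exp_le_add_exp_sq (x : ℝ) : Real.exp x ≤ x + Real.exp (x ^ 2) := by
  rcases le_or_gt |x| 1 with hx | hx
  · have h1 := Real.abs_exp_sub_one_sub_id_le hx
    have h2 := Real.add_one_le_exp (x ^ 2)
    linarith [le_abs_self (Real.exp x - 1 - x)]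
  · rcases lt_or_ge 0 x with h0 | h0
    · rw [abs_of_pos h0] at hx
      have : Real.exp x ≤ Real.exp (x ^ 2) := Real.exp_le_exp.2 (by nlinarith)
      linarith
    · rw [abs_of_nonpos h0] at hx
      have h1 : Real.exp x ≤ 1 := Real.exp_le_one_iff.2 h0
      have h2 := Real.add_one_le_exp (x ^ 2)
      nlinarith

/-- If the symmetrized Laplace transform of a centered `f` is bounded by
`exp (2 (L - 1) + 3 s²)`, then `f` is subgaussian with a constant proportional to `L`. -/
theorem integral_exp_le_of_lintegral_exp_mul_le {Ω : Type*} [MeasurableSpace Ω] {ν : Measure Ω}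
    [IsProbabilityMeasure ν] {f : Ω → ℝ} (hf : Measurable f) (h0 : ∫ x, f x ∂ν = 0) {L : ℝ}
    (hL : 1 ≤ L)
    (hb : ∀ s : ℝ, (∫⁻ x, ENNReal.ofReal (Real.exp (-s * f x)) ∂ν) *
      ∫⁻ x, ENNReal.ofReal (Real.exp (s * f x)) ∂ν ≤
        ENNReal.ofReal (Real.exp (2 * (L - 1) + 3 * s ^ 2))) (t : ℝ) :
    ∫ x, Real.exp (t * f x) ∂ν ≤ Real.exp (51 * L * t ^ 2) := by
  have hint : ∀ s : ℝ, Integrable (fun x => Real.exp (s * f x)) ν := by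
    intro s
    rw [← lintegral_ofReal_ne_top_iff_integrable (by fun_prop)
      (ae_of_all _ fun _ => by positivity)]
    intro htop
    have h := hb s
    rw [htop, ENNReal.mul_top] at h
    · exact absurd h (by simp)
    · rw [Ne, lintegral_eq_zero_iff (by fun_prop)]
      intro hz
      have hne : (ae ν).NeBot := inferInstance
      obtain ⟨x, hx⟩ := hz.exists
      simp only [Pi.zero_apply, ENNReal.ofReal_eq_zero] at hx
      linarith [Real.exp_pos (-s * f x)]
  have hfi : Integrable f ν := by
    refine ((hint 1).add (hint (-1))).mono' hf.aestronglyMeasurable (ae_of_all _ fun x => ?_)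
    simp only [Pi.add_apply, one_mul, Real.norm_eq_abs, neg_mul]
    rw [abs_le']
    have h1 := Real.add_one_le_exp (f x)
    have h2 := Real.add_one_le_exp (-f x)
    have h3 := Real.exp_pos (f x)
    have h4 := Real.exp_pos (-f x)
    constructor <;> linarith
  have hge : ∀ s : ℝ, 1 ≤ ∫⁻ x, ENNReal.ofReal (Real.exp (s * f x)) ∂ν := by
    intro s
    rw [← ofReal_integral_eq_lintegral_ofReal (hint s) (ae_of_all _ fun _ => by positivity),
      ENNReal.one_le_ofReal]
    calc (1 : ℝ) = ∫ x, (s * f x + 1) ∂ν := by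
          rw [integral_add (hfi.const_mul s) (integrable_const _), integral_const_mul, h0]
          simp
      _ ≤ _ := integral_mono ((hfi.const_mul s).add (integrable_const _)) (hint s)
          fun x => Real.add_one_le_exp _
  have hle : ∀ s : ℝ, ∫⁻ x, ENNReal.ofReal (Real.exp (s * f x)) ∂ν ≤
      ENNReal.ofReal (Real.exp (2 * (L - 1) + 3 * s ^ 2)) := fun s =>
    (le_mul_of_one_le_left (by positivity) (hge (-s))).trans (hb s)
  have hsq : ∫⁻ x, ENNReal.ofReal (Real.exp (f x ^ 2 / 24)) ∂ν ≤
      ENNReal.ofReal (Real.exp (2 * L)) := by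
    have hmgf : ∀ x, ENNReal.ofReal (Real.exp (f x ^ 2 / 24)) =
        ∫⁻ g, ENNReal.ofReal (Real.exp (f x / √12 * g)) ∂ProbabilityTheory.gaussianReal 0 1 := by
      intro x
      rw [← ofReal_integral_eq_lintegral_ofReal
        (ProbabilityTheory.integrable_exp_mul_gaussianReal _) (ae_of_all _ fun _ => by positivity)]
      have h5 := congrFun (ProbabilityTheory.mgf_fun_id_gaussianReal (μ := 0) (v := 1)) (f x / √12)
      rw [ProbabilityTheory.mgf] at h5
      rw [h5, div_pow, Real.sq_sqrt (by norm_num)]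
      congr 2
      push_cast
      ring
    simp_rw [hmgf]
    rw [lintegral_lintegral_swap (by fun_prop)]
    calc _ ≤ ∫⁻ g, ENNReal.ofReal (Real.exp (2 * (L - 1))) *
          ENNReal.ofReal (Real.exp (g ^ 2 / 4)) ∂ProbabilityTheory.gaussianReal 0 1 := by
          refine lintegral_mono fun g => ?_
          have h6 := hle (g / √12)
          rw [div_pow, Real.sq_sqrt (by norm_num)] at h6
          rw [← ENNReal.ofReal_mul (by positivity), ← Real.exp_add]
          refine (le_of_eq ?_).trans (h6.trans (le_of_eq ?_))
          · refine lintegral_congr fun x => ?_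
            congr 2
            ring
          · congr 2
            ring
      _ ≤ ENNReal.ofReal (Real.exp (2 * (L - 1))) * ENNReal.ofReal (Real.exp 2) := by
          rw [lintegral_const_mul' _ _ ENNReal.ofReal_ne_top]
          exact mul_le_mul_right lintegral_exp_sq_div_four_gaussianReal_le _
      _ = _ := by
          rw [← ENNReal.ofReal_mul (by positivity), ← Real.exp_add]
          congr 2
          ring
  have hsqi : Integrable (fun x => Real.exp (f x ^ 2 / 24)) ν := by
    rw [← lintegral_ofReal_ne_top_iff_integrable (by fun_prop)
      (ae_of_all _ fun _ => by positivity)]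
    exact ne_top_of_le_ne_top ENNReal.ofReal_ne_top hsq
  have hsq' : ∫ x, Real.exp (f x ^ 2 / 24) ∂ν ≤ Real.exp (2 * L) := by
    rw [← ofReal_integral_eq_lintegral_ofReal hsqi (ae_of_all _ fun _ => by positivity)] at hsq
    exact (ENNReal.ofReal_le_ofReal_iff (by positivity)).1 hsq
  rcases le_or_gt (24 * t ^ 2) 1 with ht | ht
  · set C := Real.exp (2 * L) with hC
    have hCpos : 0 < C := Real.exp_pos _
    set p := 24 * t ^ 2 with hp
    have hpt : ∀ x, Real.exp (t * f x) ≤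
        t * f x + C ^ p * (1 + p * (C⁻¹ * Real.exp (f x ^ 2 / 24) - 1)) := by
      intro x
      refine (exp_le_add_exp_sq _).trans (add_le_add_right ?_ _)
      have h7 := rpow_one_add_le_one_add_mul_self
        (s := C⁻¹ * Real.exp (f x ^ 2 / 24) - 1) (p := p)
        (by linarith [show 0 < C⁻¹ * Real.exp (f x ^ 2 / 24) by positivity]) (by positivity) ht
      refine le_trans (le_of_eq ?_) (mul_le_mul_of_nonneg_left h7 (by positivity))
      rw [add_sub_cancel, ← Real.mul_rpow (by positivity) (by positivity), ← mul_assoc,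
        mul_inv_cancel₀ hCpos.ne', one_mul, ← Real.exp_mul]
      congr 1
      rw [hp]
      ring
    have hlin : ∀ x, t * f x + C ^ p * (1 + p * (C⁻¹ * Real.exp (f x ^ 2 / 24) - 1)) =
        t * f x + (C ^ p * (1 - p) + C ^ p * p * C⁻¹ * Real.exp (f x ^ 2 / 24)) := by
      intro x
      ring
    simp_rw [hlin] at hpt
    have hi1 := hfi.const_mul t
    have hi2 := (integrable_const (μ := ν) (C ^ p * (1 - p))).add
      (hsqi.const_mul (C ^ p * p * C⁻¹))
    calc _ ≤ _ := integral_mono (hint t) (hi1.add hi2) hpt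
      _ = C ^ p * (1 - p) + C ^ p * p * C⁻¹ * ∫ x, Real.exp (f x ^ 2 / 24) ∂ν := by
        rw [integral_add' hi1 hi2, integral_add' (integrable_const _) (hsqi.const_mul _),
          integral_const_mul, h0]
        simp [integral_const_mul]
      _ ≤ C ^ p * (1 - p) + C ^ p * p * C⁻¹ * C := by gcongr
      _ = C ^ p := by
        field_simp
        ring
      _ = Real.exp (48 * L * t ^ 2) := by
        rw [hC, ← Real.exp_mul, hp]
        congr 1
        ring
      _ ≤ _ := Real.exp_le_exp.2 (by gcongr; norm_num)
  · have h8 := hle t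
    rw [← ofReal_integral_eq_lintegral_ofReal (hint t) (ae_of_all _ fun _ => by positivity)] at h8
    refine ((ENNReal.ofReal_le_ofReal_iff (by positivity)).1 h8).trans (Real.exp_le_exp.2 ?_)
    nlinarith [sq_nonneg t]

/-- **Corollary 5.1.** There is a universal constant `c` (independent of `n` and `A`)
such that for any Borel set `A ⊂ ℝⁿ` with `γ(A) > 0`, the subgaussian constant of the
normalized restricted measure `γ_A` satisfies `σ²(γ_A) ≤ c·log(e/γ(A))`. -/
theorem gaussian_subgaussian_restricted :
    ∃ c : ℝ, 0 < c ∧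
      ∀ (n : ℕ) (A : Set (EuclideanSpace ℝ (Fin n))),
        MeasurableSet A → 0 < stdGaussian n A →
        subgaussianConst (restrictedMeasure (stdGaussian n) A) ≤
          c * Real.log (Real.exp 1 / (stdGaussian n A).toReal) := by
  refine ⟨102, by norm_num, fun n A hA hpos => ?_⟩
  have hprob : IsProbabilityMeasure (stdGaussian n) := by
    rw [stdGaussian_eq]
    infer_instance
  set a := (stdGaussian n A).toReal with ha
  have hatop : stdGaussian n A ≠ ⊤ := measure_ne_top _ _
  have ha0 : 0 < a := ENNReal.toReal_pos hpos.ne' hatop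
  have ha1 : a ≤ 1 := by
    rw [ha]
    exact ENNReal.toReal_le_of_le_ofReal zero_le_one (by simpa using prob_le_one)
  have hLog : Real.log (Real.exp 1 / a) = 1 - Real.log a := by
    rw [Real.log_div (Real.exp_ne_zero _) ha0.ne', Real.log_exp]
  have hL : 1 ≤ Real.log (Real.exp 1 / a) := by
    rw [hLog]
    linarith [Real.log_nonpos ha0.le ha1]
  refine csInf_le ⟨0, fun _ h => h.1⟩ ⟨by positivity, fun f hf h0 t => ?_⟩
  have hcond : IsProbabilityMeasure (ProbabilityTheory.cond (stdGaussian n) A) :=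
    ProbabilityTheory.cond_isProbabilityMeasure hpos.ne'
  have hν : IsProbabilityMeasure (restrictedMeasure (stdGaussian n) A) := by
    constructor
    rw [restrictedMeasure, (MeasurableEmbedding.subtype_coe hA).comap_apply, Set.image_univ,
      Subtype.range_coe]
    exact ProbabilityTheory.cond_apply_self hpos.ne' hatop
  obtain ⟨F, hF, hfF⟩ : ∃ F : EuclideanSpace ℝ (Fin n) → ℝ, LipschitzWith 1 F ∧
      ∀ x : A, f x = F x := by
    have h1 : ∀ x : A, Function.extend Subtype.val f 0 (x : EuclideanSpace ℝ (Fin n)) = f x :=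
      fun x => Subtype.val_injective.extend_apply f 0 x
    have h2 : LipschitzOnWith 1 (Function.extend (Subtype.val : A → _) f 0) A := by
      intro x hx y hy
      rw [h1 ⟨x, hx⟩, h1 ⟨y, hy⟩]
      exact hf ⟨x, hx⟩ ⟨y, hy⟩
    obtain ⟨F, hF, hFA⟩ := h2.extend_real
    exact ⟨F, hF, fun x => (h1 x).symm.trans (hFA x.2)⟩
  have hle : ∀ s : ℝ, ∫⁻ x, ENNReal.ofReal (Real.exp (s * f x))
      ∂restrictedMeasure (stdGaussian n) A ≤ ENNReal.ofReal a⁻¹ *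
        ∫⁻ x, ENNReal.ofReal (Real.exp (s * F x)) ∂stdGaussian n := by
    intro s
    simp_rw [hfF]
    rw [restrictedMeasure,
      lintegral_subtype_comap hA fun x => ENNReal.ofReal (Real.exp (s * F x))]
    refine (setLIntegral_le_lintegral _ _).trans ?_
    rw [ProbabilityTheory.cond, lintegral_smul_measure, smul_eq_mul,
      ENNReal.ofReal_inv_of_pos ha0, ha, ENNReal.ofReal_toReal hatop]
    exact mul_le_mul_right (setLIntegral_le_lintegral _ _) _
  have hb : ∀ s : ℝ, (∫⁻ x, ENNReal.ofReal (Real.exp (-s * f x))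
      ∂restrictedMeasure (stdGaussian n) A) *
      ∫⁻ x, ENNReal.ofReal (Real.exp (s * f x)) ∂restrictedMeasure (stdGaussian n) A ≤
      ENNReal.ofReal (Real.exp (2 * (Real.log (Real.exp 1 / a) - 1) + 3 * s ^ 2)) := by
    intro s
    refine (mul_le_mul' (hle (-s)) (hle s)).trans ?_
    rw [mul_mul_mul_comm, ← ENNReal.ofReal_mul (by positivity), Real.exp_add (2 * _),
      ENNReal.ofReal_mul (p := Real.exp (2 * _)) (by positivity)]
    refine mul_le_mul' (le_of_eq ?_) ?_
    · rw [hLog, sub_sub_cancel_left, two_mul, Real.exp_add, Real.exp_neg, Real.exp_log ha0]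
    · rw [stdGaussian_eq]
      exact lintegral_exp_mul_lintegral_exp_neg_le hF s
  refine (integral_exp_le_of_lintegral_exp_mul_le hf.continuous.measurable h0 hL hb t).trans
    (le_of_eq ?_)
  congr 1
  ring
end

section
/- Let μ be the two-sided product exponential measure on ℝⁿ with density 2^{−n} e^{−(|x₁| + ⋯ + |xₙ|)} with respect to Lebesgue measure, and equip ℝⁿ with the Euclidean metric. Then there is a universal constant c (independent of n and A) such that for any Borel set A ⊂ ℝⁿ with μ(A) > 0 and any function f : A → ℝ with μ_A-mean zero and Lipschitz semi-norm ≤ 1, one has ‖f‖_{ψ₁(μ_A)} ≤ c · log(e/μ(A)); in particular, the spread constant satisfies s²(μ_A) ≤ c · log²(e/μ(A)). -/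
open MeasureTheory Real Filter

/-- The spread constant `s²(μ) = sup { Var_μ(f) : ‖f‖_Lip ≤ 1 }`. -/
noncomputable def spreadConst {M : Type*} [PseudoMetricSpace M] [MeasurableSpace M]
    (μ : Measure M) : ℝ :=
  sSup {v : ℝ | ∃ f : M → ℝ, LipschitzWith 1 f ∧
    v = ∫ x, (f x - ∫ y, f y ∂μ) ^ 2 ∂μ}

/-- The two-sided product exponential measure on Euclidean `ℝⁿ`, with density
`2^{−n} e^{−(|x₁|+⋯+|xₙ|)}` with respect to Lebesgue measure. -/
noncomputable def twoSidedExp (n : ℕ) : Measure (EuclideanSpace ℝ (Fin n)) :=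
  volume.withDensity fun x =>
    ENNReal.ofReal ((2 : ℝ) ^ (-(n : ℝ)) * Real.exp (-(∑ i, |x i|)))

open Set ProbabilityTheory

/-- The two-sided exponential (Laplace) law on the line. -/
noncomputable def laplaceMeasure : Measure ℝ :=
  volume.withDensity fun x => ENNReal.ofReal (1 / 2 * Real.exp (-|x|))

lemma integrable_laplaceMeasure_iff {f : ℝ → ℝ} :
    Integrable f laplaceMeasure ↔ Integrable fun x => 1 / 2 * Real.exp (-|x|) * f x := by
  rw [laplaceMeasure, integrable_withDensity_iff_integrable_smul₀' (by fun_prop)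
    (.of_forall fun _ => ENNReal.ofReal_lt_top)]
  refine integrable_congr (.of_forall fun x => ?_)
  simp only [smul_eq_mul]
  rw [ENNReal.toReal_ofReal (by positivity)]

lemma integral_laplaceMeasure (f : ℝ → ℝ) :
    ∫ x, f x ∂laplaceMeasure = ∫ x, 1 / 2 * Real.exp (-|x|) * f x := by
  rw [laplaceMeasure, integral_withDensity_eq_integral_toReal_smul₀ (by fun_prop)
    (.of_forall fun _ => ENNReal.ofReal_lt_top)]
  refine integral_congr_ae (.of_forall fun x => ?_)
  simp only [smul_eq_mul]
  rw [ENNReal.toReal_ofReal (by positivity)]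

lemma integrable_exp_neg_mul_abs {b : ℝ} (hb : 0 < b) :
    Integrable fun x : ℝ => Real.exp (-(b * |x|)) := by
  rw [← integrableOn_univ, ← Iic_union_Ioi (a := (0 : ℝ))]
  refine IntegrableOn.union ?_ ?_
  · refine (integrableOn_exp_mul_Iic hb 0).congr_fun (fun x hx => ?_) measurableSet_Iic
    simp only [abs_of_nonpos (mem_Iic.1 hx), mul_neg, neg_neg]
  · refine (exp_neg_integrableOn_Ioi 0 hb).congr_fun (fun x hx => ?_) measurableSet_Ioi
    simp only [abs_of_pos (mem_Ioi.1 hx), neg_mul]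

lemma integrable_exp_half_abs : Integrable (fun x => Real.exp (|x| / 2)) laplaceMeasure := by
  rw [integrable_laplaceMeasure_iff]
  refine ((integrable_exp_neg_mul_abs (b := 1 / 2) (by norm_num)).const_mul (1 / 2)).congr
    (.of_forall fun x => ?_)
  simp only [mul_assoc]
  rw [← Real.exp_add]
  ring_nf

instance : IsProbabilityMeasure laplaceMeasure := by
  constructor
  rw [laplaceMeasure, withDensity_apply _ .univ, setLIntegral_univ,
    ← ofReal_integral_eq_lintegral_ofReal _ (.of_forall fun x => by positivity)]
  · rw [integral_const_mul, integral_comp_abs (f := fun x => Real.exp (-x)),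
      integral_exp_neg_Ioi_zero]
    norm_num
  · have := (integrable_exp_neg_mul_abs (b := 1) (by norm_num)).const_mul (1 / 2)
    simpa using this

/-- A half-line Hardy inequality with exponential weight. -/
lemma setIntegral_Ioi_sq_mul_exp_neg_le {u v : ℝ → ℝ} (hu : ∀ x, HasDerivAt u (v x) x)
    (h0 : u 0 = 0) (hu2 : IntegrableOn (fun x => Real.exp (-x) * u x ^ 2) (Ioi 0))
    (hv2 : IntegrableOn (fun x => Real.exp (-x) * v x ^ 2) (Ioi 0)) :
    ∫ x in Ioi 0, Real.exp (-x) * u x ^ 2 ≤ 4 * ∫ x in Ioi 0, Real.exp (-x) * v x ^ 2 := by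
  have hv : v = deriv u := funext fun x => (hu x).deriv.symm
  have hvm : Measurable v := hv ▸ measurable_deriv u
  have hum : Measurable u :=
    (continuous_iff_continuousAt.2 fun x => (hu x).continuousAt).measurable
  have hd : ∀ x, HasDerivAt (fun x => Real.exp (-x) * u x ^ 2)
      (Real.exp (-x) * (2 * u x * v x - u x ^ 2)) x := by
    intro x
    have := ((hasDerivAt_neg x).exp).mul ((hu x).pow 2)
    convert! this using 1
    simp
    ring
  have hd_int : IntegrableOn (fun x => Real.exp (-x) * (2 * u x * v x - u x ^ 2)) (Ioi 0) := by
    refine ((hu2.const_mul 2).add hv2).mono' (by fun_prop) (.of_forall fun x => ?_)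
    rw [Real.norm_eq_abs, abs_mul, abs_of_pos (Real.exp_pos _)]
    simp only [Pi.add_apply]
    have : |2 * u x * v x - u x ^ 2| ≤ 2 * u x ^ 2 + v x ^ 2 := by
      rw [abs_le]; constructor <;> nlinarith [sq_nonneg (u x + v x), sq_nonneg (u x - v x)]
    nlinarith [Real.exp_pos (-x)]
  have hlim := tendsto_zero_of_hasDerivAt_of_integrableOn_Ioi (fun x _ => hd x) hd_int hu2
  have h1 := integral_Ioi_of_hasDerivAt_of_tendsto' (fun x _ => hd x) hd_int hlim
  simp only [h0] at h1
  have h2 : ∫ x in Ioi 0, Real.exp (-x) * (2 * u x * v x - u x ^ 2) ≤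
      ∫ x in Ioi 0, (2 * (Real.exp (-x) * v x ^ 2) - 1 / 2 * (Real.exp (-x) * u x ^ 2)) := by
    refine integral_mono hd_int ((hv2.const_mul 2).sub (hu2.const_mul (1 / 2))) fun x => ?_
    simp only
    nlinarith [mul_nonneg (Real.exp_pos (-x)).le (sq_nonneg (u x - 2 * v x))]
  rw [integral_sub (hv2.const_mul 2) (hu2.const_mul (1 / 2)), integral_const_mul,
    integral_const_mul] at h2
  norm_num at h1
  linarith

/-- Poincaré inequality for the Laplace law, centred at the value at the origin. -/
lemma integral_sq_sub_zero_le_laplaceMeasure {u v : ℝ → ℝ} (hu : ∀ x, HasDerivAt u (v x) x)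
    (hu2 : Integrable (fun x => (u x - u 0) ^ 2) laplaceMeasure)
    (hv2 : Integrable (fun x => v x ^ 2) laplaceMeasure) :
    ∫ x, (u x - u 0) ^ 2 ∂laplaceMeasure ≤ 4 * ∫ x, v x ^ 2 ∂laplaceMeasure := by
  rw [integrable_laplaceMeasure_iff] at hu2 hv2
  rw [integral_laplaceMeasure, integral_laplaceMeasure]
  have e : ∀ (f : ℝ → ℝ), IntegrableOn (fun x => 1 / 2 * Real.exp (-|x|) * f x) (Ioi 0) →
      IntegrableOn (fun x => Real.exp (-x) * f x) (Ioi 0) := by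
    intro f hf
    refine IntegrableOn.congr_fun (hf.const_mul 2) (fun x hx => ?_) measurableSet_Ioi
    simp only [abs_of_pos (mem_Ioi.1 hx)]
    ring
  have e' : ∀ (f : ℝ → ℝ), ∫ x in Ioi 0, 1 / 2 * Real.exp (-|x|) * f x =
      1 / 2 * ∫ x in Ioi 0, Real.exp (-x) * f x := by
    intro f
    rw [← integral_const_mul]
    refine setIntegral_congr_fun measurableSet_Ioi (fun x hx => ?_)
    simp only [abs_of_pos (mem_Ioi.1 hx)]
    ring
  have hneg : ∀ (f : ℝ → ℝ), ∫ x in Iic 0, 1 / 2 * Real.exp (-|x|) * f x =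
      1 / 2 * ∫ x in Ioi 0, Real.exp (-x) * f (-x) := by
    intro f
    rw [← e' fun x => f (-x)]
    have := integral_comp_neg_Ioi (0 : ℝ) (fun x => 1 / 2 * Real.exp (-|x|) * f x)
    simp only [abs_neg, neg_zero] at this
    exact this.symm
  have hnegi : ∀ (f : ℝ → ℝ), Integrable (fun x => 1 / 2 * Real.exp (-|x|) * f x) →
      IntegrableOn (fun x => Real.exp (-x) * f (-x)) (Ioi 0) := by
    intro f hf
    refine e (fun x => f (-x)) ?_
    have := hf.comp_neg.integrableOn (s := Ioi 0)
    simpa using this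
  rw [← intervalIntegral.integral_Iic_add_Ioi hu2.integrableOn hu2.integrableOn (b := 0),
    ← intervalIntegral.integral_Iic_add_Ioi hv2.integrableOn hv2.integrableOn (b := 0),
    e' fun x => (u x - u 0) ^ 2, hneg fun x => (u x - u 0) ^ 2,
    e' fun x => v x ^ 2, hneg fun x => v x ^ 2]
  have hpos := setIntegral_Ioi_sq_mul_exp_neg_le (fun x => (hu x).sub_const (u 0)) (sub_self _)
    (e _ hu2.integrableOn) (e _ hv2.integrableOn)
  have hd : ∀ x, HasDerivAt (fun x => u (-x) - u 0) (-v (-x)) x := by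
    intro x
    have := ((hu (-x)).comp x (hasDerivAt_neg x)).sub_const (u 0)
    simpa using this
  have hneg' := setIntegral_Ioi_sq_mul_exp_neg_le hd (by simp)
    (hnegi (fun x => (u x - u 0) ^ 2) hu2) (by simpa using hnegi (fun x => v x ^ 2) hv2)
  simp only [neg_sq] at hneg'
  linarith

lemma sq_integral_le_integral_sq {α : Type*} [MeasurableSpace α] {μ : Measure α}
    [IsProbabilityMeasure μ] {f : α → ℝ} (hf : Integrable f μ)
    (hf2 : Integrable (fun x => f x ^ 2) μ) : (∫ x, f x ∂μ) ^ 2 ≤ ∫ x, f x ^ 2 ∂μ := by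
  set m := ∫ x, f x ∂μ
  have h : 0 ≤ ∫ x, (f x ^ 2 - 2 * m * f x + m ^ 2) ∂μ :=
    integral_nonneg fun x => by
      have := sq_nonneg (f x - m)
      simp only [Pi.zero_apply]
      linarith
  have hsub : Integrable (fun x => f x ^ 2 - 2 * m * f x) μ := hf2.sub (hf.const_mul _)
  rw [integral_add hsub (integrable_const _), integral_sub hf2 (hf.const_mul _),
    integral_const_mul, integral_const] at h
  simp only [probReal_univ, one_smul] at h
  nlinarith

lemma integrable_of_integrable_sq {α : Type*} [MeasurableSpace α] {μ : Measure α}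
    [IsFiniteMeasure μ] {f : α → ℝ} (hf : AEStronglyMeasurable f μ)
    (hf2 : Integrable (fun x => f x ^ 2) μ) : Integrable f μ :=
  ((memLp_two_iff_integrable_sq hf).2 hf2).integrable (by norm_num)

/-- One step of the tensorization of the Poincaré inequality. -/
lemma laplaceMeasure_prod_variance_le {β : Type*} [MeasurableSpace β] {ν : Measure β}
    [IsProbabilityMeasure ν] {h D : ℝ × β → ℝ} (hm : Measurable h)
    (hd : ∀ a y, HasDerivAt (fun s => h (s, y)) (D (a, y)) a)
    (hi : Integrable (fun p => h p ^ 2) (laplaceMeasure.prod ν))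
    (hiy : ∀ a, Integrable (fun y => h (a, y) ^ 2) ν)
    (hia : ∀ y, Integrable (fun a => h (a, y) ^ 2) laplaceMeasure)
    (hDi : Integrable (fun p => D p ^ 2) (laplaceMeasure.prod ν))
    (hDia : ∀ y, Integrable (fun a => D (a, y) ^ 2) laplaceMeasure) :
    ∫ p, h p ^ 2 ∂(laplaceMeasure.prod ν) - (∫ p, h p ∂(laplaceMeasure.prod ν)) ^ 2 ≤
      ∫ a, (∫ y, h (a, y) ^ 2 ∂ν - (∫ y, h (a, y) ∂ν) ^ 2) ∂laplaceMeasure +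
        4 * ∫ p, D p ^ 2 ∂(laplaceMeasure.prod ν) := by
  set G : ℝ → ℝ := fun a => ∫ y, h (a, y) ∂ν with hG
  have hsub : ∀ {b c : ℝ}, (b - c) ^ 2 ≤ 2 * b ^ 2 + 2 * c ^ 2 := fun {b c} => by
    nlinarith [sq_nonneg (b + c)]
  have hh : Integrable h (laplaceMeasure.prod ν) :=
    integrable_of_integrable_sq hm.aestronglyMeasurable hi
  have hhy : ∀ a, Integrable (fun y => h (a, y)) ν := fun a =>
    integrable_of_integrable_sq (hm.comp measurable_prodMk_left).aestronglyMeasurable (hiy a)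
  have hma : ∀ y, Measurable fun a => h (a, y) := fun y => hm.comp measurable_prodMk_right
  have hGi : Integrable G laplaceMeasure := hh.integral_prod_left
  have hS : Integrable (fun a => ∫ y, h (a, y) ^ 2 ∂ν) laplaceMeasure := hi.integral_prod_left
  have hG2 : Integrable (fun a => G a ^ 2) laplaceMeasure := by
    refine hS.mono' (hGi.aestronglyMeasurable.pow 2) (.of_forall fun a => ?_)
    rw [Real.norm_eq_abs, abs_of_nonneg (sq_nonneg _)]
    exact sq_integral_le_integral_sq (hhy a) (hiy a)
  have hdiff : Integrable (fun p : ℝ × β => (h p - h (0, p.2)) ^ 2) (laplaceMeasure.prod ν) := by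
    refine ((hi.const_mul 2).add (((hiy 0).comp_snd laplaceMeasure).const_mul 2)).mono'
      (by fun_prop) (.of_forall fun p => ?_)
    rw [Real.norm_eq_abs, abs_of_nonneg (sq_nonneg _)]
    exact hsub
  have hGd : Integrable (fun a => (G a - G 0) ^ 2) laplaceMeasure := by
    refine ((hG2.const_mul 2).add (integrable_const (2 * G 0 ^ 2))).mono'
      ((hGi.aestronglyMeasurable.sub aestronglyMeasurable_const).pow 2) (.of_forall fun p => ?_)
    rw [Real.norm_eq_abs, abs_of_nonneg (sq_nonneg _)]
    exact hsub
  have h1 : ∫ a, G a ^ 2 ∂laplaceMeasure - (∫ a, G a ∂laplaceMeasure) ^ 2 ≤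
      ∫ a, (G a - G 0) ^ 2 ∂laplaceMeasure := by
    have : ∫ a, (G a - G 0) ^ 2 ∂laplaceMeasure =
        ∫ a, (G a ^ 2 - 2 * G 0 * G a + G 0 ^ 2) ∂laplaceMeasure := by
      congr 1; ext a; ring
    have hGsub : Integrable (fun a => G a ^ 2 - 2 * G 0 * G a) laplaceMeasure :=
      hG2.sub (hGi.const_mul _)
    rw [this, integral_add hGsub (integrable_const _),
      integral_sub hG2 (hGi.const_mul _), integral_const_mul, integral_const]
    simp only [probReal_univ, one_smul]
    nlinarith [sq_nonneg (∫ a, G a ∂laplaceMeasure - G 0)]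
  have h2 : ∫ a, (G a - G 0) ^ 2 ∂laplaceMeasure ≤
      ∫ a, ∫ y, (h (a, y) - h (0, y)) ^ 2 ∂ν ∂laplaceMeasure := by
    refine integral_mono hGd hdiff.integral_prod_left fun a => ?_
    simp only [hG]
    rw [← integral_sub (hhy a) (hhy 0)]
    refine sq_integral_le_integral_sq ((hhy a).sub (hhy 0)) ?_
    refine (((hiy a).const_mul 2).add ((hiy 0).const_mul 2)).mono' (by fun_prop)
      (.of_forall fun y => ?_)
    rw [Real.norm_eq_abs, abs_of_nonneg (sq_nonneg _)]
    exact hsub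
  have h3 : ∫ a, ∫ y, (h (a, y) - h (0, y)) ^ 2 ∂ν ∂laplaceMeasure ≤
      4 * ∫ p, D p ^ 2 ∂(laplaceMeasure.prod ν) := by
    rw [integral_integral_swap (f := fun a y => (h (a, y) - h (0, y)) ^ 2) hdiff,
      integral_prod_symm _ hDi, ← integral_const_mul]
    refine integral_mono hdiff.integral_prod_right (hDi.integral_prod_right.const_mul 4)
      fun y => ?_
    refine integral_sq_sub_zero_le_laplaceMeasure (fun a => hd a y) ?_ (hDia y)
    refine (((hia y).const_mul 2).add (integrable_const (2 * h (0, y) ^ 2))).mono'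
      (((hma y).sub_const _).pow_const 2).aestronglyMeasurable (.of_forall fun a => ?_)
    rw [Real.norm_eq_abs, abs_of_nonneg (sq_nonneg _)]
    exact hsub
  rw [integral_sub hS hG2, integral_prod _ hi, integral_prod _ hh]
  linarith

/-- The product of `n` Laplace laws. -/
noncomputable abbrev laplacePi (n : ℕ) : Measure (Fin n → ℝ) :=
  Measure.pi fun _ => laplaceMeasure

lemma integrable_exp_half_sum_abs (n : ℕ) :
    Integrable (fun x : Fin n → ℝ => Real.exp ((∑ i, |x i|) / 2)) (laplacePi n) := by
  have := Integrable.fintype_prod (𝕜 := ℝ) (ι := Fin n) (f := fun _ t => Real.exp (|t| / 2))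
    (μ := fun _ => laplaceMeasure) fun _ => integrable_exp_half_abs
  refine this.congr (.of_forall fun x => ?_)
  simp only
  rw [← Real.exp_sum, Finset.sum_div]

lemma integrable_sq_of_abs_le_exp {n : ℕ} {f : (Fin n → ℝ) → ℝ} {K : ℝ} (hf : Measurable f)
    (hK : ∀ x, |f x| ≤ K * Real.exp ((∑ i, |x i|) / 4)) :
    Integrable (fun x => f x ^ 2) (laplacePi n) := by
  refine ((integrable_exp_half_sum_abs n).const_mul (K ^ 2)).mono' (by fun_prop)
    (.of_forall fun x => ?_)
  rw [Real.norm_eq_abs, abs_of_nonneg (sq_nonneg _), ← sq_abs]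
  calc |f x| ^ 2 ≤ (K * Real.exp ((∑ i, |x i|) / 4)) ^ 2 :=
        pow_le_pow_left₀ (abs_nonneg _) (hK x) 2
    _ = K ^ 2 * Real.exp ((∑ i, |x i|) / 2) := by
        rw [mul_pow, ← Real.exp_nat_mul]; congr 2; push_cast; ring

lemma integrable_sq_laplaceMeasure_of_abs_le_exp {f : ℝ → ℝ} {K : ℝ} (hf : Measurable f)
    (hK : ∀ x, |f x| ≤ K * Real.exp (|x| / 4)) :
    Integrable (fun x => f x ^ 2) laplaceMeasure := by
  refine (integrable_exp_half_abs.const_mul (K ^ 2)).mono' (by fun_prop)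
    (.of_forall fun x => ?_)
  rw [Real.norm_eq_abs, abs_of_nonneg (sq_nonneg _), ← sq_abs]
  calc |f x| ^ 2 ≤ (K * Real.exp (|x| / 4)) ^ 2 :=
        pow_le_pow_left₀ (abs_nonneg _) (hK x) 2
    _ = K ^ 2 * Real.exp (|x| / 2) := by
        rw [mul_pow, ← Real.exp_nat_mul]; congr 2; push_cast; ring

lemma measurePreserving_cons_laplacePi (n : ℕ) :
    MeasurePreserving (MeasurableEquiv.piFinSuccAbove (fun _ : Fin (n + 1) => ℝ) 0).symm
      (laplaceMeasure.prod (laplacePi n)) (laplacePi (n + 1)) :=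
  (measurePreserving_piFinSuccAbove (fun _ : Fin (n + 1) => laplaceMeasure) 0).symm

lemma piFinSuccAbove_zero_symm_apply {n : ℕ} (p : ℝ × (Fin n → ℝ)) :
    (MeasurableEquiv.piFinSuccAbove (fun _ : Fin (n + 1) => ℝ) 0).symm p =
      (Fin.cons p.1 p.2 : Fin (n + 1) → ℝ) := by
  simp [MeasurableEquiv.piFinSuccAbove_symm_apply, Fin.insertNthEquiv]

/-- Poincaré inequality for the product of Laplace laws, for functions of moderate growth. -/
theorem laplacePi_variance_le (n : ℕ) {g : (Fin n → ℝ) → ℝ} {D : Fin n → (Fin n → ℝ) → ℝ}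
    {K : ℝ} (hg : Measurable g) (hD : ∀ i, Measurable (D i))
    (hd : ∀ i x, HasDerivAt (fun s => g (Function.update x i s)) (D i x) (x i))
    (hgK : ∀ x, |g x| ≤ K * Real.exp ((∑ i, |x i|) / 4))
    (hDK : ∀ i x, |D i x| ≤ K * Real.exp ((∑ i, |x i|) / 4)) :
    ∫ x, g x ^ 2 ∂(laplacePi n) - (∫ x, g x ∂(laplacePi n)) ^ 2 ≤
      4 * ∑ i, ∫ x, D i x ^ 2 ∂(laplacePi n) := by
  induction n generalizing K with
  | zero => rw [laplacePi, Measure.pi_of_empty fun _ => laplaceMeasure]; simp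
  | succ n ih =>
    have hmp := measurePreserving_cons_laplacePi n
    have hinteg : ∀ f : (Fin (n + 1) → ℝ) → ℝ, ∫ x, f x ∂(laplacePi (n + 1)) =
        ∫ p : ℝ × (Fin n → ℝ), f (Fin.cons p.1 p.2) ∂(laplaceMeasure.prod (laplacePi n)) := by
      intro f
      rw [← hmp.integral_comp']
      simp_rw [piFinSuccAbove_zero_symm_apply]
    have hintb : ∀ f : (Fin (n + 1) → ℝ) → ℝ, Integrable f (laplacePi (n + 1)) →
        Integrable (fun p : ℝ × (Fin n → ℝ) => f (Fin.cons p.1 p.2))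
          (laplaceMeasure.prod (laplacePi n)) := by
      intro f hf
      have := (hmp.integrable_comp_emb (MeasurableEquiv.measurableEmbedding _)).2 hf
      simpa only [Function.comp_def, piFinSuccAbove_zero_symm_apply] using this
    have hmeas : Measurable fun p : ℝ × (Fin n → ℝ) => (Fin.cons p.1 p.2 : Fin (n + 1) → ℝ) := by
      simp_rw [← piFinSuccAbove_zero_symm_apply]
      exact MeasurableEquiv.measurable _
    have hsum : ∀ (a : ℝ) (y : Fin n → ℝ),
        ∑ i, |(Fin.cons a y : Fin (n + 1) → ℝ) i| = |a| + ∑ i, |y i| := by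
      intro a y
      simp [Fin.sum_univ_succ]
    have hbdy : ∀ f : (Fin (n + 1) → ℝ) → ℝ, (∀ x, |f x| ≤ K * Real.exp ((∑ i, |x i|) / 4)) →
        ∀ a y, |f (Fin.cons a y)| ≤ (K * Real.exp (|a| / 4)) * Real.exp ((∑ i, |y i|) / 4) := by
      intro f hf a y
      refine (hf _).trans_eq ?_
      rw [hsum, mul_assoc, ← Real.exp_add, add_div]
    have hslice_y : ∀ f : (Fin (n + 1) → ℝ) → ℝ, Measurable f →
        (∀ x, |f x| ≤ K * Real.exp ((∑ i, |x i|) / 4)) →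
        ∀ a, Integrable (fun y => f (Fin.cons a y) ^ 2) (laplacePi n) := fun f hfm hf a =>
      integrable_sq_of_abs_le_exp ((hfm.comp hmeas).comp measurable_prodMk_left) (hbdy f hf a)
    have hslice_a : ∀ f : (Fin (n + 1) → ℝ) → ℝ, Measurable f →
        (∀ x, |f x| ≤ K * Real.exp ((∑ i, |x i|) / 4)) →
        ∀ y, Integrable (fun a => f (Fin.cons a y) ^ 2) laplaceMeasure := fun f hfm hf y =>
      integrable_sq_laplaceMeasure_of_abs_le_exp (K := K * Real.exp ((∑ i, |y i|) / 4))
        ((hfm.comp hmeas).comp measurable_prodMk_right) fun a =>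
          (hbdy f hf a y).trans_eq (by ring)
    have hDi : ∀ i, Integrable (fun p : ℝ × (Fin n → ℝ) => D i (Fin.cons p.1 p.2) ^ 2)
        (laplaceMeasure.prod (laplacePi n)) := fun i =>
      hintb (fun x => D i x ^ 2) (integrable_sq_of_abs_le_exp (hD i) (hDK i))
    have hgi : Integrable (fun p : ℝ × (Fin n → ℝ) => g (Fin.cons p.1 p.2) ^ 2)
        (laplaceMeasure.prod (laplacePi n)) :=
      hintb (fun x => g x ^ 2) (integrable_sq_of_abs_le_exp hg hgK)
    have key := laplaceMeasure_prod_variance_le (ν := laplacePi n)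
      (h := fun p => g (Fin.cons p.1 p.2)) (D := fun p => D 0 (Fin.cons p.1 p.2))
      (hg.comp hmeas) (fun a y => by simpa using hd 0 (Fin.cons a y)) hgi
      (hslice_y g hg hgK) (hslice_a g hg hgK) (hDi 0) (hslice_a _ (hD 0) (hDK 0))
    have hstep : ∫ a, (∫ y, g (Fin.cons a y) ^ 2 ∂(laplacePi n) -
        (∫ y, g (Fin.cons a y) ∂(laplacePi n)) ^ 2) ∂laplaceMeasure ≤
        ∫ a, 4 * ∑ i : Fin n, ∫ y, D i.succ (Fin.cons a y) ^ 2 ∂(laplacePi n)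
          ∂laplaceMeasure := by
      refine integral_mono_of_nonneg (.of_forall fun a => ?_) ?_ (.of_forall fun a => ?_)
      · refine sub_nonneg.2 (sq_integral_le_integral_sq ?_ (hslice_y g hg hgK a))
        exact integrable_of_integrable_sq
          ((hg.comp hmeas).comp measurable_prodMk_left).aestronglyMeasurable
          (hslice_y g hg hgK a)
      · exact (integrable_finsetSum _ fun i _ => (hDi i.succ).integral_prod_left).const_mul 4
      · refine ih (g := fun y => g (Fin.cons a y)) (D := fun i y => D i.succ (Fin.cons a y))
          ((hg.comp hmeas).comp measurable_prodMk_left)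
          (fun i => ((hD _).comp hmeas).comp measurable_prodMk_left) (fun i y => ?_)
          (hbdy g hgK a) (fun i => hbdy _ (hDK i.succ) a)
        simpa [Fin.cons_update] using hd i.succ (Fin.cons a y)
    rw [integral_const_mul, integral_finsetSum _ fun i _ => (hDi i.succ).integral_prod_left]
      at hstep
    rw [hinteg g, hinteg fun x => g x ^ 2, Fin.sum_univ_succ, hinteg fun x => D 0 x ^ 2]
    simp_rw [fun i : Fin n => hinteg fun x => D i.succ x ^ 2, fun i : Fin n =>
      integral_prod _ (hDi i.succ)]
    dsimp only at key
    linarith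

lemma integrable_exp_mul_of_abs_le {n : ℕ} {G : (Fin n → ℝ) → ℝ} {C t : ℝ} (hG : Measurable G)
    (hb : ∀ x, |G x| ≤ C + ∑ i, |x i|) (ht : |t| ≤ 1 / 2) :
    Integrable (fun x => Real.exp (t * G x)) (laplacePi n) := by
  refine ((integrable_exp_half_sum_abs n).const_mul (Real.exp (|t| * C))).mono'
    (by fun_prop) (.of_forall fun x => ?_)
  rw [Real.norm_eq_abs, abs_of_pos (Real.exp_pos _), ← Real.exp_add, Real.exp_le_exp]
  have hs : 0 ≤ ∑ i, |x i| := by positivity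
  calc t * G x ≤ |t| * |G x| := by rw [← abs_mul]; exact le_abs_self _
    _ ≤ |t| * (C + ∑ i, |x i|) := by gcongr; exact hb x
    _ ≤ |t| * C + (∑ i, |x i|) / 2 := by nlinarith

/-- The dyadic step of the Herbst-type argument of Aida and Stroock. -/
lemma laplacePi_mgf_mul_le {n : ℕ} {G : (Fin n → ℝ) → ℝ} {D : Fin n → (Fin n → ℝ) → ℝ} {C t : ℝ}
    (hG : Measurable G) (hD : ∀ i, Measurable (D i))
    (hd : ∀ i x, HasDerivAt (fun s => G (Function.update x i s)) (D i x) (x i))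
    (hD1 : ∀ x, ∑ i, D i x ^ 2 ≤ 1) (hC : 0 ≤ C) (hb : ∀ x, |G x| ≤ C + ∑ i, |x i|)
    (ht0 : 0 ≤ t) (ht : t ≤ 1 / 2) :
    mgf G (laplacePi n) t * (1 - t ^ 2) ≤ mgf G (laplacePi n) (t / 2) ^ 2 := by
  have hgb : ∀ x, Real.exp (t / 2 * G x) ≤ Real.exp (C / 4) * Real.exp ((∑ i, |x i|) / 4) := by
    intro x
    rw [← Real.exp_add, Real.exp_le_exp]
    have hs : 0 ≤ ∑ i, |x i| := by positivity
    have := (le_abs_self _).trans (hb x)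
    nlinarith
  have hDabs : ∀ i x, |t / 2 * D i x| ≤ 1 := by
    intro i x
    have h1 : D i x ^ 2 ≤ 1 :=
      (Finset.single_le_sum (f := fun i => D i x ^ 2) (fun _ _ => sq_nonneg _)
        (Finset.mem_univ i)).trans (hD1 x)
    have h2 : |D i x| ≤ 1 := by rwa [← sq_le_one_iff_abs_le_one]
    rw [abs_mul, abs_of_nonneg (by positivity)]
    nlinarith [abs_nonneg (D i x)]
  have hgm : Measurable fun x => Real.exp (t / 2 * G x) := by fun_prop
  have hDm : ∀ i, Measurable fun x => t / 2 * D i x * Real.exp (t / 2 * G x) := fun i =>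
    ((hD i).const_mul _).mul hgm
  have hDb : ∀ i x, |t / 2 * D i x * Real.exp (t / 2 * G x)| ≤
      Real.exp (C / 4) * Real.exp ((∑ i, |x i|) / 4) := by
    intro i x
    rw [abs_mul, abs_of_pos (Real.exp_pos _)]
    exact (mul_le_of_le_one_left (Real.exp_pos _).le (hDabs i x)).trans (hgb x)
  have key := laplacePi_variance_le n (g := fun x => Real.exp (t / 2 * G x))
    (D := fun i x => t / 2 * D i x * Real.exp (t / 2 * G x)) hgm hDm
    (fun i x => by
      have := ((hd i x).const_mul (t / 2)).exp
      simpa [mul_comm] using this)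
    (fun x => by rw [abs_of_pos (Real.exp_pos _)]; exact hgb x) hDb
  have hsq : ∀ x, Real.exp (t / 2 * G x) ^ 2 = Real.exp (t * G x) := fun x => by
    rw [← Real.exp_nat_mul]; congr 1; push_cast; ring
  have hgrad : ∑ i, ∫ x, (t / 2 * D i x * Real.exp (t / 2 * G x)) ^ 2 ∂(laplacePi n) ≤
      t ^ 2 / 4 * mgf G (laplacePi n) t := by
    rw [← integral_finsetSum _ fun i _ => integrable_sq_of_abs_le_exp (hDm i) (hDb i), mgf,
      ← integral_const_mul]
    refine integral_mono
      (integrable_finsetSum _ fun i _ => integrable_sq_of_abs_le_exp (hDm i) (hDb i))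
      ((integrable_exp_mul_of_abs_le hG hb
        (by rwa [abs_of_nonneg ht0])).const_mul _) fun x => ?_
    simp only
    have : ∑ i, (t / 2 * D i x * Real.exp (t / 2 * G x)) ^ 2 =
        (t ^ 2 / 4 * Real.exp (t * G x)) * ∑ i, D i x ^ 2 := by
      rw [Finset.mul_sum]
      refine Finset.sum_congr rfl fun i _ => ?_
      rw [← hsq]; ring
    rw [this]
    exact mul_le_of_le_one_right (by positivity) (hD1 x)
  simp only [hsq] at key
  change mgf G (laplacePi n) t - mgf G (laplacePi n) (t / 2) ^ 2 ≤ _ at key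
  nlinarith

/-- Dimension-free exponential integrability under the product of Laplace laws. -/
lemma laplacePi_integral_exp_half_le {n : ℕ} {G : (Fin n → ℝ) → ℝ}
    {D : Fin n → (Fin n → ℝ) → ℝ} {C : ℝ}
    (hG : Measurable G) (hD : ∀ i, Measurable (D i))
    (hd : ∀ i x, HasDerivAt (fun s => G (Function.update x i s)) (D i x) (x i))
    (hD1 : ∀ x, ∑ i, D i x ^ 2 ≤ 1) (hC : 0 ≤ C) (hb : ∀ x, |G x| ≤ C + ∑ i, |x i|)
    (hmean : ∫ x, G x ∂(laplacePi n) = 0) :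
    ∫ x, Real.exp (1 / 2 * G x) ∂(laplacePi n) ≤ Real.exp 1 := by
  have hinteg : ∀ t : ℝ, |t| ≤ 1 / 2 → Integrable (fun x => Real.exp (t * G x)) (laplacePi n) :=
    fun t ht => integrable_exp_mul_of_abs_le hG hb ht
  have hpos : ∀ t : ℝ, |t| ≤ 1 / 2 → 0 < mgf G (laplacePi n) t := fun t ht => mgf_pos (hinteg t ht)
  set L := cgf G (laplacePi n) with hL
  have hhalf : ∀ t, 0 < t → t ≤ 1 / 2 → L t / t ≤ L (t / 2) / (t / 2) + 2 * t := by
    intro t ht0 ht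
    have h := laplacePi_mgf_mul_le hG hD hd hD1 hC hb ht0.le ht
    have ht2 : t ^ 2 ≤ 1 / 4 := by nlinarith
    have h1 : (0 : ℝ) < 1 - t ^ 2 := by linarith
    have hp := hpos t (by rwa [abs_of_pos ht0])
    have h2 := Real.log_le_log (mul_pos hp h1) h
    rw [Real.log_mul hp.ne' h1.ne', Real.log_pow] at h2
    have h3 := Real.one_sub_inv_le_log_of_pos h1
    have h4 : (1 - t ^ 2)⁻¹ ≤ 1 + 2 * t ^ 2 := by
      rw [inv_le_iff_one_le_mul₀ h1]; nlinarith [sq_nonneg t]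
    have h5 : L t ≤ 2 * L (t / 2) + 2 * t ^ 2 := by
      simp only [hL, cgf]; push_cast at h2; linarith
    have : L (t / 2) / (t / 2) + 2 * t = (2 * L (t / 2) + 2 * t ^ 2) / t := by
      field_simp
    rw [this]
    gcongr
  have hiter : ∀ k : ℕ, L (1 / 2) / (1 / 2) ≤
      L (1 / 2 / 2 ^ k) / (1 / 2 / 2 ^ k) + (2 - 4 * (1 / 2 / 2 ^ k)) := by
    intro k
    induction k with
    | zero => norm_num
    | succ k ih =>
      have hk : (1 : ℝ) ≤ 2 ^ k := one_le_pow₀ (by norm_num)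
      have h := hhalf (1 / 2 / 2 ^ k) (by positivity) (div_le_self (by norm_num) hk)
      have e : (1 : ℝ) / 2 / 2 ^ (k + 1) = 1 / 2 / 2 ^ k / 2 := by rw [pow_succ]; field_simp
      rw [e]
      linarith
  have hmem : (0 : ℝ) ∈ interior (integrableExpSet G (laplacePi n)) := by
    rw [mem_interior]
    refine ⟨Ioo (-(1 / 2)) (1 / 2), fun t ht => ?_, isOpen_Ioo, by norm_num⟩
    exact hinteg t (abs_le.2 ⟨ht.1.le, ht.2.le⟩)
  have hder : HasDerivAt L 0 0 := by
    have h := (analyticAt_cgf hmem).differentiableAt.hasDerivAt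
    rwa [deriv_cgf_zero hmem, hmean, zero_div] at h
  have hseq : Tendsto (fun k : ℕ => (1 : ℝ) / 2 / 2 ^ k) atTop (nhdsWithin 0 {0}ᶜ) := by
    refine tendsto_nhdsWithin_iff.2 ⟨?_, .of_forall fun k => by
      simp⟩
    have := (tendsto_pow_atTop_nhds_zero_of_lt_one (r := (1 / 2 : ℝ)) (by norm_num)
      (by norm_num)).const_mul (1 / 2)
    simpa [div_eq_mul_inv] using this
  have hslope := (hasDerivAt_iff_tendsto_slope.1 hder).comp hseq
  have hle : L (1 / 2) / (1 / 2) ≤ 0 + 2 := by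
    refine ge_of_tendsto' (hslope.add_const 2) fun k => (hiter k).trans ?_
    simp only [Function.comp_apply, slope_def_field, sub_zero]
    have : L 0 = 0 := by simp [hL]
    rw [this, sub_zero]
    have : (0 : ℝ) ≤ 4 * (1 / 2 / 2 ^ k) := by positivity
    linarith
  have hfin : L (1 / 2) ≤ 1 := by linarith
  change mgf G (laplacePi n) (1 / 2) ≤ _
  rw [← Real.log_le_iff_le_exp (hpos _ (by norm_num [abs_of_pos]))]
  exact hfin

lemma laplacePi_eq_withDensity (n : ℕ) :
    laplacePi n = (volume : Measure (Fin n → ℝ)).withDensity fun x =>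
      ENNReal.ofReal (∏ i, 1 / 2 * Real.exp (-|x i|)) := by
  have hi : Integrable fun t : ℝ => 1 / 2 * Real.exp (-|t|) := by
    simpa using (integrable_exp_neg_mul_abs (b := 1) (by norm_num)).const_mul (1 / 2)
  refine Measure.pi_eq fun s hs => ?_
  rw [withDensity_apply _ (MeasurableSet.univ_pi hs), volume_pi, Measure.restrict_pi_pi,
    ← ofReal_integral_eq_lintegral_ofReal
      (Integrable.fintype_prod (f := fun _ t => 1 / 2 * Real.exp (-|t|)) fun i => hi.restrict)
      (.of_forall fun x => Finset.prod_nonneg fun i _ => by positivity),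
    integral_fintype_prod_eq_prod (fun _ t => 1 / 2 * Real.exp (-|t|)),
    ENNReal.ofReal_prod_of_nonneg fun i _ => integral_nonneg fun t => by positivity]
  refine Finset.prod_congr rfl fun i _ => ?_
  rw [laplaceMeasure, withDensity_apply _ (hs i),
    ofReal_integral_eq_lintegral_ofReal hi.restrict (.of_forall fun x => by positivity)]

lemma measurePreserving_toLp_laplacePi (n : ℕ) :
    MeasurePreserving (MeasurableEquiv.toLp 2 (Fin n → ℝ)) (laplacePi n) (twoSidedExp n) := by
  refine ⟨MeasurableEquiv.measurable _, Measure.ext fun s hs => ?_⟩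
  have hvol : MeasurePreserving (MeasurableEquiv.toLp 2 (Fin n → ℝ)) :=
    PiLp.volume_preserving_toLp (Fin n)
  rw [MeasurableEquiv.map_apply, laplacePi_eq_withDensity,
    withDensity_apply _ ((MeasurableEquiv.measurable _) hs), twoSidedExp, withDensity_apply _ hs,
    ← hvol.setLIntegral_comp_preimage_emb (MeasurableEquiv.measurableEmbedding _)]
  refine lintegral_congr fun x => ?_
  congr 1
  rw [Finset.prod_mul_distrib, ← Real.exp_sum, Finset.sum_neg_distrib]
  simp [Real.rpow_neg]

instance (n : ℕ) : IsProbabilityMeasure (twoSidedExp n) :=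
  (measurePreserving_toLp_laplacePi n).map_eq ▸
    Measure.isProbabilityMeasure_map (MeasurableEquiv.measurable _).aemeasurable

open scoped Convolution in
/-- A Lipschitz function is at distance at most `1` from a smooth function that is Lipschitz with
the same constant. -/
lemma exists_contDiff_lipschitzWith_one_abs_sub_le {E : Type*} [NormedAddCommGroup E]
    [NormedSpace ℝ E] [FiniteDimensional ℝ E] {F : E → ℝ} (hF : LipschitzWith 1 F) :
    ∃ S : E → ℝ, ContDiff ℝ 1 S ∧ LipschitzWith 1 S ∧ ∀ x, |S x - F x| ≤ 1 := by
  borelize E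
  let μ : Measure E := Measure.addHaar
  let φ : ContDiffBump (0 : E) := ⟨1 / 2, 1, by norm_num, by norm_num⟩
  have hcs := φ.hasCompactSupport_normed (μ := μ)
  have hcd : ContDiff ℝ 1 (φ.normed μ) := φ.contDiff_normed
  have hinteg : ∀ x, Integrable (fun t => φ.normed μ t * F (x - t)) μ := fun x => by
    refine Continuous.integrable_of_hasCompactSupport ?_ hcs.mul_right
    exact hcd.continuous.mul (hF.continuous.comp (continuous_const.sub continuous_id))
  refine ⟨φ.normed μ ⋆[ContinuousLinearMap.lsmul ℝ ℝ, μ] F,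
    hcs.contDiff_convolution_left _ hcd hF.continuous.locallyIntegrable,
    LipschitzWith.of_dist_le_mul fun x y => ?_, fun x => ?_⟩
  · simp only [convolution_def, ContinuousLinearMap.lsmul_apply, smul_eq_mul]
    rw [Real.dist_eq, ← integral_sub (hinteg x) (hinteg y), NNReal.coe_one, one_mul]
    calc |∫ t, (φ.normed μ t * F (x - t) - φ.normed μ t * F (y - t)) ∂μ|
        ≤ ∫ t, φ.normed μ t * dist x y ∂μ := by
          rw [← Real.norm_eq_abs]
          refine norm_integral_le_of_norm_le
            ((hcd.continuous.integrable_of_hasCompactSupport (μ := μ) hcs).mul_const _)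
            (.of_forall fun t => ?_)
          rw [← mul_sub, Real.norm_eq_abs, abs_mul, abs_of_nonneg (φ.nonneg_normed (μ := μ) t)]
          refine mul_le_mul_of_nonneg_left ?_ (φ.nonneg_normed (μ := μ) t)
          have := hF.dist_le_mul (x - t) (y - t)
          rwa [NNReal.coe_one, one_mul, dist_sub_right, Real.dist_eq] at this
      _ = dist x y := by rw [integral_mul_const, φ.integral_normed, one_mul]
  · refine φ.dist_normed_convolution_le hF.continuous.aestronglyMeasurable fun y hy => ?_
    have := hF.dist_le_mul y x
    rw [NNReal.coe_one, one_mul] at this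
    exact this.trans (Metric.mem_ball.1 hy).le

lemma sum_sq_apply_single_le_one {n : ℕ} {L : EuclideanSpace ℝ (Fin n) →L[ℝ] ℝ} (hL : ‖L‖ ≤ 1) :
    ∑ i, L (EuclideanSpace.single i 1) ^ 2 ≤ 1 := by
  set v : EuclideanSpace ℝ (Fin n) := ∑ i, L (EuclideanSpace.single i 1) •
    EuclideanSpace.single i (1 : ℝ) with hv
  have hvi : ∀ i, v i = L (EuclideanSpace.single i 1) := fun i => by
    simp [hv, Finset.sum_apply, Pi.single_apply]
  have h1 : L v = ∑ i, L (EuclideanSpace.single i 1) ^ 2 := by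
    simp [hv, sq]
  have h2 : ‖v‖ ^ 2 = ∑ i, L (EuclideanSpace.single i 1) ^ 2 := by
    simp [EuclideanSpace.norm_sq_eq, hvi]
  have h3 : L v ≤ ‖v‖ := by
    calc L v ≤ ‖L v‖ := le_abs_self _
      _ ≤ ‖L‖ * ‖v‖ := L.le_opNorm v
      _ ≤ ‖v‖ := mul_le_of_le_one_left (norm_nonneg _) hL
  rw [h1, ← h2] at h3
  rw [← h2]
  nlinarith [norm_nonneg v]

lemma norm_toLp_le_sum_abs {n : ℕ} (x : Fin n → ℝ) : ‖WithLp.toLp 2 x‖ ≤ ∑ i, |x i| := by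
  rw [EuclideanSpace.norm_eq]
  refine Real.sqrt_le_iff.2 ⟨by positivity, ?_⟩
  simpa using Finset.sum_sq_le_sq_sum_of_nonneg (s := Finset.univ) (f := fun i => |x i|)
    fun i _ => abs_nonneg _

/-- Dimension-free exponential concentration of Lipschitz functions under `twoSidedExp`. -/
lemma twoSidedExp_concentration {n : ℕ} {F : EuclideanSpace ℝ (Fin n) → ℝ}
    (hF : LipschitzWith 1 F) :
    ∃ m : ℝ, Integrable (fun x => Real.exp (|F x - m| / 2)) (twoSidedExp n) ∧
      ∫ x, Real.exp (|F x - m| / 2) ∂(twoSidedExp n) ≤ Real.exp 3 := by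
  obtain ⟨S, hS, hSL, hSF⟩ := exists_contDiff_lipschitzWith_one_abs_sub_le hF
  set m := ∫ x, S (WithLp.toLp 2 x) ∂(laplacePi n) with hm
  set G : (Fin n → ℝ) → ℝ := fun x => S (WithLp.toLp 2 x) - m with hG
  set D : Fin n → (Fin n → ℝ) → ℝ := fun i x =>
    fderiv ℝ S (WithLp.toLp 2 x) (EuclideanSpace.single i 1) with hD
  have htoLp : Continuous fun x : Fin n → ℝ => WithLp.toLp 2 x := PiLp.continuous_toLp 2 _
  have hGm : Measurable G := ((hS.continuous.comp htoLp).sub continuous_const).measurable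
  have hDm : ∀ i, Measurable (D i) := fun i =>
    (((hS.continuous_fderiv (by norm_num)).comp htoLp).clm_apply continuous_const).measurable
  have hd : ∀ i x, HasDerivAt (fun s => G (Function.update x i s)) (D i x) (x i) := by
    intro i x
    have h1 : HasFDerivAt S (fderiv ℝ S (WithLp.toLp 2 x))
        (WithLp.toLp 2 (Function.update x i (x i))) := by
      rw [Function.update_eq_self]
      exact (hS.differentiable (by norm_num) _).hasFDerivAt
    have h2 : HasDerivAt (fun s => WithLp.toLp 2 (Function.update x i s))
        (EuclideanSpace.single i (1 : ℝ)) (x i) := by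
      have := (PiLp.hasFDerivAt_toLp (𝕜 := ℝ) 2 (Function.update x i (x i))).comp_hasDerivAt
        (x i) (hasDerivAt_update x i (x i))
      convert! this using 1
    exact (h1.comp_hasDerivAt (x i) h2).sub_const m
  have hD1 : ∀ x, ∑ i, D i x ^ 2 ≤ 1 := fun x =>
    sum_sq_apply_single_le_one (by simpa using norm_fderiv_le_of_lipschitz ℝ hSL)
  have hb : ∀ x, |G x| ≤ |S 0 - m| + ∑ i, |x i| := by
    intro x
    have h1 := hSL.dist_le_mul (WithLp.toLp 2 x) 0
    rw [NNReal.coe_one, one_mul, dist_zero_right, Real.dist_eq] at h1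
    have h2 := abs_add_le (S (WithLp.toLp 2 x) - S 0) (S 0 - m)
    rw [sub_add_sub_cancel] at h2
    linarith [norm_toLp_le_sum_abs x]
  have hexp : ∀ t : ℝ, |t| ≤ 1 / 2 → Integrable (fun x => Real.exp (t * G x)) (laplacePi n) :=
    fun t ht => integrable_exp_mul_of_abs_le hGm hb ht
  have hp := hexp (1 / 2) (by norm_num [abs_of_pos])
  have hn := hexp (-(1 / 2)) (by norm_num [abs_of_pos])
  have hGi : Integrable G (laplacePi n) := by
    refine ((hp.add hn).const_mul 2).mono' hGm.aestronglyMeasurable (.of_forall fun x => ?_)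
    rw [Real.norm_eq_abs, Pi.add_apply]
    have h1 := Real.add_one_le_exp (1 / 2 * G x)
    have h2 := Real.add_one_le_exp (-(1 / 2) * G x)
    have h3 := Real.exp_pos (1 / 2 * G x)
    have h4 := Real.exp_pos (-(1 / 2) * G x)
    rw [abs_le]
    constructor <;> linarith
  have hmean : ∫ x, G x ∂(laplacePi n) = 0 := by
    have hSi : Integrable (fun x => S (WithLp.toLp 2 x)) (laplacePi n) := by
      exact (hGi.add (integrable_const m)).congr (.of_forall fun x => by simp [hG])
    rw [hG, integral_sub hSi (integrable_const _)]
    simp [hm]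
  have hP := laplacePi_integral_exp_half_le hGm hDm hd hD1 (abs_nonneg _) hb hmean
  have hN := laplacePi_integral_exp_half_le (G := fun x => -G x) (D := fun i x => -D i x)
    hGm.neg (fun i => (hDm i).neg) (fun i x => (hd i x).neg) (by simpa using hD1)
    (abs_nonneg _) (by simpa using hb) (by rw [integral_neg, hmean, neg_zero])
  simp only [mul_neg, ← neg_mul] at hN
  have hle : ∀ x, Real.exp (|F (WithLp.toLp 2 x) - m| / 2) ≤
      Real.exp (1 / 2) * (Real.exp (1 / 2 * G x) + Real.exp (-(1 / 2) * G x)) := by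
    intro x
    have h1 := hSF (WithLp.toLp 2 x)
    have h2 : |F (WithLp.toLp 2 x) - m| ≤ 1 + |G x| := by
      have := abs_sub_le (F (WithLp.toLp 2 x)) (S (WithLp.toLp 2 x)) m
      rw [abs_sub_comm] at h1
      simp only [hG]
      linarith
    calc Real.exp (|F (WithLp.toLp 2 x) - m| / 2) ≤ Real.exp (1 / 2 + 1 / 2 * |G x|) := by
          gcongr; linarith
      _ = Real.exp (1 / 2) * Real.exp (1 / 2 * |G x|) := Real.exp_add _ _
      _ ≤ _ := by
        gcongr
        rcases abs_cases (G x) with ⟨h, _⟩ | ⟨h, _⟩ <;> rw [h]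
        · linarith [Real.exp_pos (-(1 / 2) * G x)]
        · rw [mul_neg, ← neg_mul]; linarith [Real.exp_pos (1 / 2 * G x)]
  have hdom := (hp.add hn).const_mul (Real.exp (1 / 2))
  have hFi : Integrable (fun x => Real.exp (|F (WithLp.toLp 2 x) - m| / 2)) (laplacePi n) := by
    refine hdom.mono' ?_ (.of_forall fun x => ?_)
    · have := hF.continuous.comp htoLp
      exact (Real.continuous_exp.comp
        ((this.sub continuous_const).abs.div_const 2)).aestronglyMeasurable
    · rw [Real.norm_eq_abs, abs_of_pos (Real.exp_pos _)]
      exact hle x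
  have hmp := measurePreserving_toLp_laplacePi n
  refine ⟨m, (hmp.integrable_comp_emb (MeasurableEquiv.measurableEmbedding _)).1 hFi, ?_⟩
  rw [← hmp.integral_comp']
  calc ∫ x, Real.exp (|F (WithLp.toLp 2 x) - m| / 2) ∂(laplacePi n)
      ≤ ∫ x, Real.exp (1 / 2) * (Real.exp (1 / 2 * G x) + Real.exp (-(1 / 2) * G x))
        ∂(laplacePi n) := integral_mono hFi hdom hle
    _ = Real.exp (1 / 2) * (∫ x, Real.exp (1 / 2 * G x) ∂(laplacePi n) +
        ∫ x, Real.exp (-(1 / 2) * G x) ∂(laplacePi n)) := by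
      rw [integral_const_mul, integral_add hp hn]
    _ ≤ Real.exp (1 / 2) * (Real.exp 1 * Real.exp 1) := by
      gcongr
      nlinarith [Real.add_one_le_exp (1 : ℝ)]
    _ ≤ Real.exp 3 := by
      rw [← Real.exp_add, ← Real.exp_add]
      gcongr
      norm_num

/-- Exponential integrability around some centre controls the `ψ₁` scale of a centred variable. -/
lemma integral_exp_abs_div_le_two {Ω : Type*} [MeasurableSpace Ω] {ρ : Measure Ω}
    [IsProbabilityMeasure ρ] {f : Ω → ℝ} {m a r : ℝ} (hf : AEStronglyMeasurable f ρ)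
    (ha : 1 ≤ a) (hr : 6 * a ≤ r)
    (hi : Integrable (fun x => Real.exp (|f x - m| / 2)) ρ)
    (hb : ∫ x, Real.exp (|f x - m| / 2) ∂ρ ≤ Real.exp a) (h0 : ∫ x, f x ∂ρ = 0) :
    Integrable (fun x => Real.exp (|f x| / r)) ρ ∧ ∫ x, Real.exp (|f x| / r) ∂ρ ≤ 2 := by
  have hr0 : 0 < r := by linarith
  have hexp : ∀ x, Real.exp (|f x - m| / 2 - a) = Real.exp (-a) * Real.exp (|f x - m| / 2) :=
    fun x => by rw [← Real.exp_add]; ring_nf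
  have hi' : Integrable (fun x => Real.exp (|f x - m| / 2 - a)) ρ := by
    simp_rw [hexp]; exact hi.const_mul _
  have hb' : ∫ x, Real.exp (|f x - m| / 2 - a) ∂ρ ≤ 1 := by
    simp_rw [hexp]
    rw [integral_const_mul, ← Real.exp_zero, ← neg_add_cancel a, Real.exp_add]
    gcongr
  have hfm : Integrable (fun x => f x - m) ρ := by
    refine (hi.const_mul 2).mono' (hf.sub aestronglyMeasurable_const) (.of_forall fun x => ?_)
    rw [Real.norm_eq_abs]
    linarith [Real.add_one_le_exp (|f x - m| / 2)]
  have hmean : |m| ≤ 2 * a := by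
    have hfi : Integrable f ρ := (hfm.add (integrable_const m)).congr
      (.of_forall fun x => by simp)
    have h1 : ∫ x, (f x - m) ∂ρ = -m := by
      rw [integral_sub hfi (integrable_const m), h0]; simp
    have h2 : |m| ≤ ∫ x, |f x - m| ∂ρ := by
      rw [← abs_neg, ← h1]; exact abs_integral_le_integral_abs
    have h3 : ∫ x, |f x - m| ∂ρ ≤ ∫ x, (2 * (a - 1) + 2 * Real.exp (|f x - m| / 2 - a)) ∂ρ := by
      refine integral_mono hfm.abs ((integrable_const _).add (hi'.const_mul 2)) fun x => ?_
      simp only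
      linarith [Real.add_one_le_exp (|f x - m| / 2 - a)]
    rw [integral_add (integrable_const _) (hi'.const_mul 2), integral_const] at h3
    simp only [integral_const_mul, probReal_univ, one_smul] at h3
    linarith
  set θ := 2 / r with hθ
  have hθ0 : 0 ≤ θ := by positivity
  have hθ1 : θ ≤ 1 := (div_le_one hr0).2 (by linarith)
  have hθa : 2 * (θ * a) ≤ 2 / 3 := by
    rw [hθ, div_mul_eq_mul_div, ← mul_div_assoc, div_le_iff₀ hr0]
    linarith
  have hpt : ∀ x, Real.exp (|f x| / r) ≤
      Real.exp (2 * (θ * a)) * (1 - θ + θ * Real.exp (|f x - m| / 2 - a)) := by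
    intro x
    have h1 : |f x| ≤ |f x - m| + 2 * a := by
      have := abs_add_le (f x - m) m
      rw [sub_add_cancel] at this
      linarith
    have h2 : |f x| / r ≤ 2 * (θ * a) + θ * (|f x - m| / 2 - a) := by
      calc |f x| / r ≤ (|f x - m| + 2 * a) / r := by gcongr
        _ = _ := by rw [hθ]; field_simp; ring
    have h3 := convexOn_exp.2 (mem_univ 0) (mem_univ (|f x - m| / 2 - a))
      (sub_nonneg.2 hθ1) hθ0 (sub_add_cancel 1 θ)
    simp only [smul_eq_mul, mul_zero, zero_add, Real.exp_zero, mul_one] at h3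
    calc Real.exp (|f x| / r) ≤ Real.exp (2 * (θ * a) + θ * (|f x - m| / 2 - a)) :=
          Real.exp_le_exp.2 h2
      _ = Real.exp (2 * (θ * a)) * Real.exp (θ * (|f x - m| / 2 - a)) := Real.exp_add _ _
      _ ≤ _ := by gcongr
  have hdom : Integrable (fun x => Real.exp (2 * (θ * a)) *
      (1 - θ + θ * Real.exp (|f x - m| / 2 - a))) ρ :=
    ((integrable_const _).add (hi'.const_mul θ)).const_mul _
  have hinteg : Integrable (fun x => Real.exp (|f x| / r)) ρ := by
    refine hdom.mono' ?_ (.of_forall fun x => ?_)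
    · exact (Real.continuous_exp.comp (continuous_abs.div_const r)).comp_aestronglyMeasurable hf
    · rw [Real.norm_eq_abs, abs_of_pos (Real.exp_pos _)]
      exact hpt x
  refine ⟨hinteg, (integral_mono hinteg hdom hpt).trans ?_⟩
  rw [integral_const_mul, integral_add (integrable_const _) (hi'.const_mul θ),
    integral_const_mul, integral_const]
  simp only [probReal_univ, one_smul]
  have h2 : Real.exp (2 * (θ * a)) ≤ 2 := by
    rw [← Real.le_log_iff_exp_le (by norm_num)]
    linarith [Real.log_two_gt_d9]
  have h3 : 1 - θ + θ * ∫ x, Real.exp (|f x - m| / 2 - a) ∂ρ ≤ 1 := by nlinarith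
  calc _ ≤ Real.exp (2 * (θ * a)) * 1 := by gcongr
    _ ≤ 2 := by rwa [mul_one]

lemma isProbabilityMeasure_restrictedMeasure {M : Type*} [MeasurableSpace M] {μ : Measure M}
    [IsFiniteMeasure μ] {A : Set M} (hA : MeasurableSet A) (h0 : 0 < μ A) :
    IsProbabilityMeasure (restrictedMeasure μ A) := by
  have := cond_isProbabilityMeasure h0.ne'
  refine (MeasurableEmbedding.subtype_coe hA).isProbabilityMeasure_comap ?_
  rw [Subtype.range_coe]
  exact (ae_cond_mem hA)

lemma map_val_restrictedMeasure {M : Type*} [MeasurableSpace M] (μ : Measure M)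
    {A : Set M} (hA : MeasurableSet A) :
    (restrictedMeasure μ A).map Subtype.val = (μ A)⁻¹ • μ.restrict A := by
  rw [restrictedMeasure, map_comap_subtype_coe hA, ProbabilityTheory.cond, Measure.restrict_smul,
    Measure.restrict_restrict hA, inter_self]

lemma integral_restrictedMeasure_le {M : Type*} [MeasurableSpace M] {μ : Measure M} {A : Set M}
    (hA : MeasurableSet A) (h0 : 0 < μ A) {g : M → ℝ} (hg : Integrable g μ) (hg0 : ∀ x, 0 ≤ g x) :
    Integrable (fun x : A => g x) (restrictedMeasure μ A) ∧
      ∫ x : A, g x ∂(restrictedMeasure μ A) ≤ (μ A).toReal⁻¹ * ∫ x, g x ∂μ := by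
  have he := MeasurableEmbedding.subtype_coe hA
  constructor
  · refine (he.integrable_map_iff (g := g)).1 ?_
    rw [map_val_restrictedMeasure μ hA]
    exact hg.restrict.smul_measure (ENNReal.inv_ne_top.2 h0.ne')
  · rw [← he.integral_map, map_val_restrictedMeasure μ hA, integral_smul_measure,
      ENNReal.toReal_inv, smul_eq_mul]
    exact mul_le_mul_of_nonneg_left (setIntegral_le_integral hg (.of_forall hg0)) (by positivity)

lemma restricted_twoSidedExp_integral_exp_abs_div_le_two {n : ℕ}
    {A : Set (EuclideanSpace ℝ (Fin n))} (hA : MeasurableSet A) (h0 : 0 < twoSidedExp n A)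
    {f : A → ℝ} (hf : LipschitzWith 1 f)
    (hmean : ∫ x, f x ∂(restrictedMeasure (twoSidedExp n) A) = 0) {r : ℝ}
    (hr : r = 18 * Real.log (Real.exp 1 / (twoSidedExp n A).toReal)) :
    0 < r ∧ Integrable (fun x => Real.exp (|f x| / r)) (restrictedMeasure (twoSidedExp n) A) ∧
      ∫ x, Real.exp (|f x| / r) ∂(restrictedMeasure (twoSidedExp n) A) ≤ 2 := by
  have := isProbabilityMeasure_restrictedMeasure hA h0
  set p := (twoSidedExp n A).toReal
  have hp : 0 < p := ENNReal.toReal_pos h0.ne' (measure_ne_top _ _)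
  have hp1 : p ≤ 1 := ENNReal.toReal_le_of_le_ofReal zero_le_one (by simpa using prob_le_one)
  have hlog : Real.log p ≤ 0 := Real.log_nonpos hp.le hp1
  rw [Real.log_div (Real.exp_pos _).ne' hp.ne', Real.log_exp] at hr
  have hext : LipschitzOnWith 1 (Function.extend Subtype.val f 0) A := by
    rw [lipschitzOnWith_iff_restrict]
    convert! hf using 1
    ext x
    exact Subtype.val_injective.extend_apply f 0 x
  obtain ⟨F, hF, hFf⟩ := hext.extend_real
  have hFf' : ∀ x : A, F x = f x := fun x =>
    (hFf x.2).symm.trans (Subtype.val_injective.extend_apply f 0 x)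
  obtain ⟨m, hmi, hmb⟩ := twoSidedExp_concentration hF
  obtain ⟨hi, hb⟩ := integral_restrictedMeasure_le hA h0 hmi fun x => (Real.exp_pos _).le
  simp only [hFf'] at hi hb
  refine ⟨by linarith, integral_exp_abs_div_le_two (a := 3 - Real.log p)
    hf.continuous.measurable.aestronglyMeasurable (by linarith) (by linarith) hi ?_ hmean⟩
  refine hb.trans ?_
  rw [Real.exp_sub, Real.exp_log hp, div_eq_inv_mul]
  gcongr

/-- **Corollary 5.3.** There is a universal constant `c` (independent of `n` and `A`)
such that for any Borel `A ⊂ ℝⁿ` with `μ(A) > 0` and any `f : A → ℝ` with `μ_A`-mean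
zero and Lipschitz semi-norm ≤ 1, one has `‖f‖_{ψ₁(μ_A)} ≤ c·log(e/μ(A))`, and in
particular `s²(μ_A) ≤ c·log²(e/μ(A))`. -/
theorem exponential_restricted :
    ∃ c : ℝ, 0 < c ∧
      ∀ (n : ℕ) (A : Set (EuclideanSpace ℝ (Fin n))),
        MeasurableSet A → 0 < twoSidedExp n A →
        (∀ f : A → ℝ, LipschitzWith 1 f →
          (∫ x, f x ∂(restrictedMeasure (twoSidedExp n) A)) = 0 →
          psiNorm (restrictedMeasure (twoSidedExp n) A) 1 f ≤
            c * Real.log (Real.exp 1 / (twoSidedExp n A).toReal)) ∧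
        spreadConst (restrictedMeasure (twoSidedExp n) A) ≤
          c * Real.log (Real.exp 1 / (twoSidedExp n A).toReal) ^ 2 := by
  refine ⟨1296, by norm_num, fun n A hA h0 => ⟨fun f hf hmean => ?_, ?_⟩⟩
  · obtain ⟨hr, -, hle⟩ :=
      restricted_twoSidedExp_integral_exp_abs_div_le_two hA h0 hf hmean rfl
    have hpsi : psiNorm (restrictedMeasure (twoSidedExp n) A) 1 f ≤ _ :=
      csInf_le ⟨0, fun s hs => hs.1.le⟩ ⟨hr, by simpa only [Real.rpow_one] using hle⟩
    linarith
  · have := isProbabilityMeasure_restrictedMeasure hA h0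
    refine Real.sSup_le ?_ (by positivity)
    rintro v ⟨f, hf, rfl⟩
    set ρ := restrictedMeasure (twoSidedExp n) A
    set m := ∫ y, f y ∂ρ
    have hmean : ∫ x, (f x - m) ∂ρ = 0 := by
      by_cases hfi : Integrable f ρ
      · rw [integral_sub hfi (integrable_const m)]
        simp [m]
      · refine integral_undef fun h => hfi ?_
        exact (h.add (integrable_const m)).congr (.of_forall fun x => by simp)
    have hL : LipschitzWith 1 fun x => f x - m :=
      LipschitzWith.of_dist_le_mul fun x y => by
        rw [dist_sub_right]; exact hf.dist_le_mul x y
    obtain ⟨hr, hi, hle⟩ :=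
      restricted_twoSidedExp_integral_exp_abs_div_le_two hA h0 hL hmean rfl
    set r := 18 * Real.log (Real.exp 1 / (twoSidedExp n A).toReal) with hr_def
    calc ∫ x, (f x - m) ^ 2 ∂ρ ≤ ∫ x, 2 * r ^ 2 * Real.exp (|f x - m| / r) ∂ρ := by
          refine integral_mono_of_nonneg (.of_forall fun x => sq_nonneg _) (hi.const_mul _)
            (.of_forall fun x => ?_)
          have h := Real.quadratic_le_exp_of_nonneg (x := |f x - m| / r) (by positivity)
          have h1 : 0 ≤ |f x - m| / r := by positivity
          have h2 : (f x - m) ^ 2 = r ^ 2 * (|f x - m| / r) ^ 2 := by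
            rw [div_pow, sq_abs]; field_simp
          simp only [h2]
          nlinarith [sq_nonneg r]
      _ ≤ 2 * r ^ 2 * 2 := by
          rw [integral_const_mul]
          gcongr
      _ = _ := by rw [hr_def]; ring
end
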